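/- arXiv:1708.07927 — 7 statements merged into one kernel-verified Lean document; each statement's English description precedes it below -/
import Mathlib

section
/- Let X be an infinite Tychonoff space and let τ be an infinite cardinal with uncountable cofinality. If C_p^2(X) has a discrete subspace of cardinality τ, then there exists a natural number n ≥ 1 such that s(X^n) ≥ τ, i.e., the n-th power X^n (with the product topology) has discrete subspaces of cardinality at least τ (the spread of X^n is at least τ). -/
open Cardinal Set

universe u

/-- `C_p(X)`: continuous real-valued functions with the topology of pointwise
convergence (subspace of the product `X → ℝ`). -/
def Cp (X : Type u) [TopologicalSpace X] : Type u := {f : X → ℝ // Continuous f}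

instance (X : Type u) [TopologicalSpace X] : TopologicalSpace (Cp X) :=
  inferInstanceAs (TopologicalSpace {f : X → ℝ // Continuous f})

/-- The spread of a space: the supremum of cardinalities of its discrete subspaces. -/
noncomputable def spread (Y : Type u) [TopologicalSpace Y] : Cardinal.{u} :=
  ⨆ D : {D : Set Y // DiscreteTopology ↥D}, #↥D.1

/-- The weight of a space: the least cardinality of a topological basis. -/
noncomputable def weight (X : Type u) [TopologicalSpace X] : Cardinal.{u} :=
  ⨅ B : {B : Set (Set X) // TopologicalSpace.IsTopologicalBasis B}, #↥B.1

/-- The i-weight of a space: the least weight of a coarser Tychonoff topology on the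
same underlying set. -/
noncomputable def iweight (X : Type u) [t : TopologicalSpace X] : Cardinal.{u} :=
  ⨅ t' : {t' : TopologicalSpace X // t ≤ t' ∧ @T35Space X t'}, @weight X t'.1

/-- The σ-product of `X^ω` with basepoint `b`: all points of the countable power
differing from `b` in at most finitely many coordinates. -/
def sigmaProd (X : Type u) [TopologicalSpace X] (b : ℕ → X) : Set (ℕ → X) :=
  {y | {n | y n ≠ b n}.Finite}

/-- A set of pairs of continuous functions separates points of `X`. -/
def PointSep2 {X : Type u} [TopologicalSpace X] (F : Set (Cp X × Cp X)) : Prop :=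
  ∀ x y : X, x ≠ y → ∃ p ∈ F, p.1.1 x ≠ p.1.1 y ∨ p.2.1 x ≠ p.2.1 y

/-- A set of continuous functions separates points of `X`. -/
def PointSep1 {X : Type u} [TopologicalSpace X] (F : Set (Cp X)) : Prop :=
  ∀ x y : X, x ≠ y → ∃ f ∈ F, f.1 x ≠ f.1 y

/-- A point-separating set in `C_p^m(X)`. -/
def PointSepM {X : Type u} [TopologicalSpace X] {m : ℕ} (F : Set (Fin m → Cp X)) : Prop :=
  ∀ x y : X, x ≠ y → ∃ f ∈ F, ∃ i, (f i).1 x ≠ (f i).1 y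

/-- A functionally closed set (zero-set). -/
def FunctionallyClosed {X : Type u} [TopologicalSpace X] (A : Set X) : Prop :=
  ∃ g : X → ℝ, Continuous g ∧ A = g ⁻¹' {0}

/-- Zero-dimensionality in the sense of covering dimension (`dim X = 0`): any two disjoint
functionally closed sets are separated by a clopen set. -/
def ZeroDimensional (X : Type u) [TopologicalSpace X] : Prop :=
  ∀ A B : Set X, FunctionallyClosed A → FunctionallyClosed B → Disjoint A B →
    ∃ U : Set X, IsClopen U ∧ A ⊆ U ∧ Disjoint U B

lemma exists_finset_nhd {X : Type u} [TopologicalSpace X] (D : Set (Cp X × Cp X))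
    [DiscreteTopology ↥D] (d : Cp X × Cp X) (hd : d ∈ D) :
    ∃ (k : ℕ) (x : Fin k → X) (B : Fin k → TopologicalSpace.countableBasis (ℝ × ℝ)),
      (∀ i, (d.1.1 (x i), d.2.1 (x i)) ∈ (B i).1) ∧
      ∀ e ∈ D, (∀ i, (e.1.1 (x i), e.2.1 (x i)) ∈ (B i).1) → e = d := by
  classical
  have h1 : IsOpen ({⟨d, hd⟩} : Set ↥D) := isOpen_discrete _
  obtain ⟨U, hU, hUd⟩ := isOpen_induced_iff.1 h1
  have hdU : d ∈ U := by
    have : (⟨d, hd⟩ : ↥D) ∈ Subtype.val ⁻¹' U := by rw [hUd]; rfl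
    exact this
  have hUD : ∀ e ∈ D, e ∈ U → e = d := by
    intro e he heU
    have : (⟨e, he⟩ : ↥D) ∈ Subtype.val ⁻¹' U := heU
    rw [hUd] at this
    exact congrArg Subtype.val this
  obtain ⟨V, W, hV, hW, hdV, hdW, hVW⟩ := isOpen_prod_iff.1 hU d.1 d.2 hdU
  obtain ⟨V', hV', rfl⟩ := isOpen_induced_iff.1 hV
  obtain ⟨W', hW', rfl⟩ := isOpen_induced_iff.1 hW
  obtain ⟨I, u, hu, huV⟩ := isOpen_pi_iff.1 hV' _ hdV
  obtain ⟨J, v, hv, hvW⟩ := isOpen_pi_iff.1 hW' _ hdW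
  have key : ∀ a : X, ∃ B ∈ TopologicalSpace.countableBasis (ℝ × ℝ),
      (d.1.1 a, d.2.1 a) ∈ B ∧
        B ⊆ (if a ∈ I then u a else univ) ×ˢ (if a ∈ J then v a else univ) := by
    intro a
    have hopen : IsOpen ((if a ∈ I then u a else univ) ×ˢ (if a ∈ J then v a else univ)) := by
      apply IsOpen.prod
      · split_ifs with h
        · exact (hu a h).1
        · exact isOpen_univ
      · split_ifs with h
        · exact (hv a h).1
        · exact isOpen_univ
    refine (TopologicalSpace.isBasis_countableBasis (ℝ × ℝ)).exists_subset_of_mem_open ?_ hopen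
    constructor
    · show _ ∈ (if a ∈ I then u a else univ)
      split_ifs with h
      · exact (hu a h).2
      · trivial
    · show _ ∈ (if a ∈ J then v a else univ)
      split_ifs with h
      · exact (hv a h).2
      · trivial
  choose B hB hdB hBs using key
  let s := I ∪ J
  refine ⟨s.card, fun i => (s.equivFin.symm i).1, fun i => ⟨B (s.equivFin.symm i).1, hB _⟩,
    fun i => hdB _, ?_⟩
  intro e he hei
  have hall : ∀ a ∈ s, (e.1.1 a, e.2.1 a) ∈ B a := by
    intro a ha
    have := hei (s.equivFin ⟨a, ha⟩)
    simpa using this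
  apply hUD e he
  apply hVW
  constructor
  · apply huV
    intro a ha
    have h := (hBs a (hall a (Finset.mem_union_left _ ha))).1
    have ha' : a ∈ I := ha
    simpa [ha'] using h
  · apply hvW
    intro a ha
    have h := (hBs a (hall a (Finset.mem_union_right _ ha))).2
    have ha' : a ∈ J := ha
    simpa [ha'] using h

/-- If `C_p^2(X)` has a discrete subspace of infinite cardinality `τ` with uncountable
cofinality, then `s(X^n) ≥ τ` for some `n ≥ 1`. -/
theorem stmt0 {X : Type u} [TopologicalSpace X] [T35Space X] [Infinite X]
    (τ : Cardinal.{u}) (hτ : ℵ₀ ≤ τ) (hcf : ℵ₀ < τ.ord.cof)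
    (hD : ∃ D : Set (Cp X × Cp X), DiscreteTopology ↥D ∧ #↥D = τ) :
    ∃ n : ℕ, 1 ≤ n ∧ τ ≤ spread (Fin n → X) := by
  obtain ⟨D, hDd, hDc⟩ := hD
  have key := fun d : ↥D => exists_finset_nhd D d.1 d.2
  choose k x B hxB hB using key
  let c : ↥D → ULift.{u} (Σ k : ℕ, Fin k → TopologicalSpace.countableBasis (ℝ × ℝ)) :=
    fun d => ⟨⟨k d, B d⟩⟩
  haveI : Countable (TopologicalSpace.countableBasis (ℝ × ℝ)) :=
    (TopologicalSpace.countable_countableBasis (ℝ × ℝ)).to_subtype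
  obtain ⟨⟨⟨n, A⟩⟩, ha⟩ := Cardinal.infinite_pigeonhole_card c τ hDc.ge hτ
    (lt_of_le_of_lt Cardinal.mk_le_aleph0 hcf)
  have hex : ∀ d : ↥(c ⁻¹' {⟨⟨n, A⟩⟩}), ∃ y : Fin n → X,
      (∀ i, (d.1.1.1.1 (y i), d.1.1.2.1 (y i)) ∈ (A i).1) ∧
      ∀ e ∈ D, (∀ i, (e.1.1 (y i), e.2.1 (y i)) ∈ (A i).1) → e = d.1.1 := by
    rintro ⟨d, hd⟩
    have hd' : (⟨k d, B d⟩ : Σ k : ℕ, Fin k → TopologicalSpace.countableBasis (ℝ × ℝ)) = ⟨n, A⟩ :=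
      congrArg ULift.down hd
    have aux : ∀ (kd : ℕ) (xd : Fin kd → X)
        (Bd : Fin kd → TopologicalSpace.countableBasis (ℝ × ℝ)),
        (∀ i, (d.1.1.1 (xd i), d.1.2.1 (xd i)) ∈ (Bd i).1) →
        (∀ e ∈ D, (∀ i, (e.1.1 (xd i), e.2.1 (xd i)) ∈ (Bd i).1) → e = d.1) →
        (⟨kd, Bd⟩ : Σ k : ℕ, Fin k → TopologicalSpace.countableBasis (ℝ × ℝ)) = ⟨n, A⟩ →
        ∃ y : Fin n → X, (∀ i, (d.1.1.1 (y i), d.1.2.1 (y i)) ∈ (A i).1) ∧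
          ∀ e ∈ D, (∀ i, (e.1.1 (y i), e.2.1 (y i)) ∈ (A i).1) → e = d.1 := by
      intro kd xd Bd h1 h2 h3
      cases h3
      exact ⟨xd, h1, h2⟩
    exact aux _ _ _ (hxB d) (hB d) hd'
  choose y hy1 hy2 using hex
  have hinj : Function.Injective y := by
    intro d e hde
    have := hy2 d e.1.1 e.1.2 (by rw [hde]; exact hy1 e)
    exact (Subtype.ext (Subtype.ext this)).symm
  have hcard : τ ≤ #↥(range y) := by
    rw [Cardinal.mk_range_eq y hinj]; exact ha
  refine ⟨n, ?_, ?_⟩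
  · rcases Nat.eq_zero_or_pos n with rfl | h
    · exfalso
      have h1 : #↥(range y) < ℵ₀ := Cardinal.lt_aleph0_of_finite _
      exact absurd (hτ.trans hcard) (not_le.2 h1)
    · exact h
  · have hdisc : DiscreteTopology ↥(range y) := by
      rw [discreteTopology_iff_isOpen_singleton]
      rintro ⟨_, d, rfl⟩
      refine isOpen_induced_iff.2
        ⟨{z | ∀ i, (d.1.1.1.1 (z i), d.1.1.2.1 (z i)) ∈ (A i).1}, ?_, ?_⟩
      · rw [setOf_forall]
        refine isOpen_iInter_of_finite fun i => ?_
        have hA := TopologicalSpace.isOpen_of_mem_countableBasis (A i).2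
        have c1 := d.1.1.1.2
        have c2 := d.1.1.2.2
        exact hA.preimage ((c1.comp (continuous_apply i)).prodMk (c2.comp (continuous_apply i)))
      · ext ⟨_, e, rfl⟩
        constructor
        · intro h
          have := hy2 e d.1.1 d.1.2 h
          have hde : d = e := Subtype.ext (Subtype.ext this)
          subst hde; rfl
        · intro h
          have h' : y e = y d := congrArg Subtype.val h
          show ∀ i, _
          simp only [h']
          exact hy1 d
    exact hcard.trans (le_ciSup (f := fun D : {D : Set (Fin n → X) // DiscreteTopology ↥D} => #↥D.1)
      (Cardinal.bddAbove_range _) ⟨range y, hdisc⟩)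
end

section
/- Let X be an infinite Tychonoff space and let τ be an infinite cardinal with cf(τ) = ω. If C_p^2(X) has a discrete subspace of cardinality τ, then s(σ_X) ≥ τ, i.e., the σ-product σ_X of the countable power X^ω has discrete subspaces of cardinality at least τ. -/
open Cardinal Set

universe u

/-- A point of a discrete subspace of `C_p^2(X)` is isolated by finitely many conditions
coming from a countable base of the reals. -/
theorem isolate_aux {X : Type u} [TopologicalSpace X] (D : Set (Cp X × Cp X))
    (hD : DiscreteTopology ↥D) (d : D) :
    ∃ (N : ℕ) (x : Fin N → X) (B : Fin N → (TopologicalSpace.countableBasis ℝ) ×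
      (TopologicalSpace.countableBasis ℝ)),
      (∀ i, d.1.1.1 (x i) ∈ (B i).1.1 ∧ d.1.2.1 (x i) ∈ (B i).2.1) ∧
      ∀ e : D, (∀ i, e.1.1.1 (x i) ∈ (B i).1.1 ∧ e.1.2.1 (x i) ∈ (B i).2.1) → e = d := by
  classical
  obtain ⟨U, hU, hUd⟩ := isOpen_induced_iff.1 (isOpen_discrete ({d} : Set D))
  have hdU : d.1 ∈ U := by
    have : d ∈ ((↑) : D → Cp X × Cp X) ⁻¹' U := by rw [hUd]; rfl
    exact this
  obtain ⟨V, W, hV, hW, hdV, hdW, hVW⟩ := isOpen_prod_iff.1 hU d.1.1 d.1.2 hdU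
  obtain ⟨V', hV', rfl⟩ := isOpen_induced_iff.1 hV
  obtain ⟨W', hW', rfl⟩ := isOpen_induced_iff.1 hW
  obtain ⟨S, u, hu, hSu⟩ := isOpen_pi_iff.1 hV' _ hdV
  obtain ⟨T, v, hv, hTv⟩ := isOpen_pi_iff.1 hW' _ hdW
  have key : ∀ (S : Finset X) (u : X → Set ℝ) (f : X → ℝ),
      (∀ a ∈ S, IsOpen (u a) ∧ f a ∈ u a) → ∀ x, ∃ B : TopologicalSpace.countableBasis ℝ,
        f x ∈ B.1 ∧ (x ∈ S → B.1 ⊆ u x) := by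
    intro S u f h x
    by_cases hx : x ∈ S
    · obtain ⟨B, hB, h1, h2⟩ :=
        (TopologicalSpace.isBasis_countableBasis ℝ).exists_subset_of_mem_open (h x hx).2 (h x hx).1
      exact ⟨⟨B, hB⟩, h1, fun _ => h2⟩
    · obtain ⟨B, hB, h1, h2⟩ :=
        (TopologicalSpace.isBasis_countableBasis ℝ).exists_subset_of_mem_open
          (mem_univ (f x)) isOpen_univ
      exact ⟨⟨B, hB⟩, h1, fun h => absurd h hx⟩
  choose P hP1 hP2 using key S u _ hu
  choose Q hQ1 hQ2 using key T v _ hv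
  let q := (S ∪ T).equivFin
  refine ⟨(S ∪ T).card, fun i => (q.symm i).1, fun i => (P (q.symm i).1, Q (q.symm i).1),
    fun i => ⟨hP1 _, hQ1 _⟩, fun e he => ?_⟩
  have he' : ∀ x ∈ S ∪ T, e.1.1.1 x ∈ (P x).1 ∧ e.1.2.1 x ∈ (Q x).1 := by
    intro x hx
    have := he (q ⟨x, hx⟩)
    simpa using this
  have heU : e.1 ∈ U := by
    apply hVW
    refine ⟨hSu ?_, hTv ?_⟩
    · intro x hx
      exact hP2 x hx (he' x (Finset.mem_union_left _ hx)).1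
    · intro x hx
      exact hQ2 x hx (he' x (Finset.mem_union_right _ hx)).2
  have : e ∈ ((↑) : D → Cp X × Cp X) ⁻¹' U := heU
  rw [hUd] at this
  exact this

/-- A family of points isolated by open sets gives a lower bound for the spread. -/
theorem le_spread_aux {Y : Type u} [TopologicalSpace Y] {ι : Type u} (p : ι → Y)
    (O : ι → Set Y) (hO : ∀ i, IsOpen (O i)) (hp : ∀ i, p i ∈ O i)
    (h : ∀ i j, p j ∈ O i → j = i) : #ι ≤ spread Y := by
  have hinj : Function.Injective p := fun i j hij => h j i (hij ▸ hp j)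
  have hd : DiscreteTopology ↥(range p) := by
    rw [discreteTopology_iff_isOpen_singleton]
    rintro ⟨_, i, rfl⟩
    refine isOpen_induced_iff.2 ⟨O i, hO i, ?_⟩
    ext ⟨_, j, rfl⟩
    simp only [mem_preimage, mem_singleton_iff]
    constructor
    · intro hj
      have := h i j hj
      subst this
      rfl
    · intro hj
      have := congrArg Subtype.val hj
      change p j = p i at this
      rw [this]
      exact hp i
  rw [← mk_range_eq p hinj]
  exact le_ciSup (f := fun D : {D : Set Y // DiscreteTopology ↥D} => #↥D.1)
    Cardinal.bddAbove_of_small ⟨range p, hd⟩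

/-- If `C_p^2(X)` has a discrete subspace of infinite cardinality `τ` with `cf(τ) = ω`,
then `s(σ_X) ≥ τ`. -/
theorem stmt1 {X : Type u} [TopologicalSpace X] [T35Space X] [Infinite X]
    (τ : Cardinal.{u}) (hτ : ℵ₀ ≤ τ) (hcf : τ.ord.cof = ℵ₀)
    (hD : ∃ D : Set (Cp X × Cp X), DiscreteTopology ↥D ∧ #↥D = τ) :
    ∀ b : ℕ → X, τ ≤ spread ↥(sigmaProd X b) := by
  classical
  intro b
  obtain ⟨D, hD, hDτ⟩ := hD
  by_contra hlt
  rw [not_le] at hlt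
  set κ := spread ↥(sigmaProd X b) with hκ
  have hinfκ : ℵ₀ ≤ κ := by
    rw [Cardinal.aleph0_le]
    intro n
    obtain ⟨s, hs⟩ := Infinite.exists_subset_card_eq X n
    have hmem : ∀ x : X, Function.update b 0 x ∈ sigmaProd X b := by
      intro x
      refine (Set.finite_singleton 0).subset ?_
      intro m hm
      by_contra hne
      exact hm (Function.update_of_ne hne _ _)
    have := le_spread_aux (ι := s) (fun x => (⟨_, hmem x.1⟩ : sigmaProd X b))
      (fun x => {y | y.1 0 ∉ ((s.erase x.1 : Finset X) : Set X)})
      (fun x => by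
        have h1 : IsOpen (((s.erase x.1 : Finset X) : Set X)ᶜ) :=
          (s.erase x.1).finite_toSet.isClosed.isOpen_compl
        have h2 : Continuous (fun y : sigmaProd X b => y.1 0) :=
          (continuous_apply 0).comp continuous_subtype_val
        exact h1.preimage h2)
      (fun x => by simp) (fun x y hy => by
        by_contra hne
        apply hy
        simp only [Function.update_self]
        simpa using fun h => hne (Subtype.ext h))
    simpa [hs] using this
  choose N x B hB1 hB2 using isolate_aux D hD
  let K := Σ N : ℕ, (Fin N → (TopologicalSpace.countableBasis ℝ) ×
      (TopologicalSpace.countableBasis ℝ))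
  have : Countable (TopologicalSpace.countableBasis ℝ) :=
    (TopologicalSpace.countable_countableBasis ℝ).to_subtype
  have : Countable K := inferInstance
  obtain ⟨c, hc⟩ := exists_injective_nat K
  have : Infinite κ.out := by rw [Cardinal.infinite_iff, Cardinal.mk_out]; exact hinfκ
  let g : ℕ ↪ κ.out := Infinite.natEmbedding _
  obtain ⟨a, ha⟩ := Cardinal.infinite_pigeonhole_card_lt
    (fun d : D => g (c ⟨N d, B d⟩)) (by rw [Cardinal.mk_out, hDτ]; exact hlt)
    (by rw [hDτ]; exact hτ)
  rw [Cardinal.mk_out] at ha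
  refine absurd ha (not_lt.2 ?_)
  set F := (fun d : D => g (c ⟨N d, B d⟩)) ⁻¹' {a} with hF
  have hFeq : ∀ d e : F, (⟨N d.1, B d.1⟩ : K) = ⟨N e.1, B e.1⟩ := by
    intro d e
    exact hc (g.injective (d.2.trans e.2.symm))
  let p : D → ℕ → X := fun d n => if h : n < N d then x d ⟨n, h⟩ else b n
  have hp : ∀ d, p d ∈ sigmaProd X b := by
    intro d
    refine (Set.finite_lt_nat (N d)).subset ?_
    intro n hn
    by_contra hne
    exact hn (dif_neg hne)
  have hpx : ∀ d (i : Fin (N d)), p d i = x d i := fun d i => dif_pos i.2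
  refine le_spread_aux (fun d : F => (⟨p d.1, hp d.1⟩ : sigmaProd X b))
    (fun d => {y | ∀ i : Fin (N d.1), d.1.1.1.1 (y.1 i) ∈ (B d.1 i).1.1 ∧
      d.1.1.2.1 (y.1 i) ∈ (B d.1 i).2.1}) ?_ ?_ ?_
  · intro d
    have hcont : ∀ i : ℕ, Continuous (fun y : sigmaProd X b => y.1 i) := fun i =>
      (continuous_apply i).comp continuous_subtype_val
    have hopen : ∀ C : TopologicalSpace.countableBasis ℝ, IsOpen C.1 := fun C =>
      TopologicalSpace.isOpen_of_mem_countableBasis C.2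
    simp only [ofPred_forall]
    refine isOpen_iInter_of_finite fun i => ?_
    exact ((hopen _).preimage (d.1.1.1.2.comp (hcont i))).inter
      ((hopen _).preimage (d.1.1.2.2.comp (hcont i)))
  · intro d i
    simp only [hpx]
    exact hB1 d.1 i
  · intro d e he
    have : ∀ k l : K, k = l → (∀ i : Fin k.1, d.1.1.1.1 (p e.1 i) ∈ (k.2 i).1.1 ∧
      d.1.1.2.1 (p e.1 i) ∈ (k.2 i).2.1) → (∀ i : Fin l.1, d.1.1.1.1 (p e.1 i) ∈ (l.2 i).1.1 ∧
      d.1.1.2.1 (p e.1 i) ∈ (l.2 i).2.1) := by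
      rintro k _ rfl h
      exact h
    have h2 := this _ _ (hFeq d e) he
    simp only [hpx] at h2
    exact (Subtype.ext (hB2 e.1 d.1 h2)).symm
end

section
/- Let X be an infinite Tychonoff space. If C_p(X) or C_p^2(X) has a discrete point-separating subspace of infinite cardinality τ with cf(τ) > ω, then there exists a natural number n ≥ 1 such that s(X^n) ≥ τ ≥ iw(X). -/
open Cardinal Set

universe u

theorem iweight_le_aux {X : Type u} [t : TopologicalSpace X] {ι : Type u} {E : Type}
    [TopologicalSpace E] [SecondCountableTopology E] [T35Space E] (hι : ℵ₀ ≤ #ι)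
    (F : ι → X → E) (hF : ∀ i, Continuous (F i))
    (hsep : ∀ x y, x ≠ y → ∃ i, F i x ≠ F i y) : iweight X ≤ #ι := by
  obtain ⟨b, hb⟩ := TopologicalSpace.exists_seq_basis E
  let t' : TopologicalSpace X := ⨅ i, TopologicalSpace.induced (F i) inferInstance
  have hle : t ≤ t' :=
    le_iInf fun i => (hF i).le_induced
  have ht : @T35Space X t' := by
    have h1 : @CompletelyRegularSpace X t' :=
      completelyRegularSpace_iInf fun i => completelyRegularSpace_induced inferInstance _
    have hc : ∀ i, @Continuous X E t' _ (F i) := fun i =>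
      continuous_iff_le_induced.2 (iInf_le _ i)
    have h2 : @T0Space X t' := by
      refine @T0Space.mk X t' fun x y hxy => ?_
      by_contra hne
      obtain ⟨i, hi⟩ := hsep x y hne
      exact hi (@Inseparable.map X E t' _ x y (F i) hxy (hc i)).eq
    exact @T35Space.mk X t' h2 h1
  have hgen : t' = TopologicalSpace.generateFrom
      (range fun p : ι × ULift.{u} ℕ => F p.1 ⁻¹' b p.2.down) := by
    have : ∀ i, TopologicalSpace.induced (F i) inferInstance =
        TopologicalSpace.generateFrom (preimage (F i) '' range b) := fun i => by
      rw [← induced_generateFrom_eq, ← hb.eq_generateFrom]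
    simp only [t', this]
    rw [← generateFrom_iUnion]
    congr 1
    ext s
    simp
  have hB := @TopologicalSpace.isTopologicalBasis_of_subbasis X t' _ hgen
  have hw : @weight X t' ≤ #ι := by
    refine (ciInf_le' _ ⟨_, hB⟩).trans ?_
    have hinf : Infinite (ι × ULift.{u} ℕ) := by
      have : Infinite ι := Cardinal.infinite_iff.2 hι
      infer_instance
    have hcard : #(Finset (ι × ULift.{u} ℕ)) = #ι := by
      rw [Cardinal.mk_finset_of_infinite]
      simp [Cardinal.mul_eq_left hι hι Cardinal.aleph0_ne_zero]
    rw [← hcard]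
    classical
    refine (Cardinal.mk_le_mk_of_subset ?_).trans (Cardinal.mk_range_le
      (f := fun A : Finset (ι × ULift.{u} ℕ) =>
        ⋂₀ ((fun p : ι × ULift.{u} ℕ => F p.1 ⁻¹' b p.2.down) '' (A : Set _))))
    rintro _ ⟨f, ⟨hf, hs⟩, rfl⟩
    rw [← image_univ] at hs
    lift f to Finset (Set X) using hf
    obtain ⟨A, -, hA⟩ := Finset.subset_set_image_iff.1 hs
    exact ⟨A, by simp [← hA]⟩
  exact (ciInf_le' _ ⟨t', hle, ht⟩).trans hw

theorem spread_aux {X : Type u} [TopologicalSpace X] {ι : Type u} {E : Type}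
    [TopologicalSpace E] [SecondCountableTopology E] (hι : ℵ₀ ≤ #ι)
    (hcf : ℵ₀ < (#ι).ord.cof)
    (F : ι → X → E) (hF : ∀ i, Continuous (F i))
    (hdisc : ∀ i, ∃ U : Set (X → E), IsOpen U ∧ ∀ j, F j ∈ U ↔ j = i) :
    ∃ n : ℕ, 1 ≤ n ∧ #ι ≤ spread (Fin n → X) := by
  obtain ⟨b, hb⟩ := TopologicalSpace.exists_seq_basis E
  have key : ∀ i, ∃ (c : Σ n : ℕ, (Fin n → ℕ)) (x : Fin c.1 → X),
      ∀ j, (∀ k, F j (x k) ∈ b (c.2 k)) ↔ j = i := by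
    intro i
    obtain ⟨U, hU, hUi⟩ := hdisc i
    obtain ⟨I, u, hu, hIU⟩ := isOpen_pi_iff.1 hU (F i) ((hUi i).2 rfl)
    have hv : ∀ a : I, ∃ m, F i a ∈ b m ∧ b m ⊆ u a := by
      intro a
      obtain ⟨_, ⟨m, rfl⟩, h1, h2⟩ := hb.exists_subset_of_mem_open (hu a a.2).2 (hu a a.2).1
      exact ⟨m, h1, h2⟩
    choose m hm1 hm2 using hv
    refine ⟨⟨I.card, fun k => m (I.equivFin.symm k)⟩, fun k => I.equivFin.symm k, fun j => ?_⟩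
    constructor
    · intro h
      refine (hUi j).1 (hIU fun a ha => ?_)
      have := h (I.equivFin ⟨a, ha⟩)
      simp only [Equiv.symm_apply_apply] at this
      exact hm2 _ this
    · rintro rfl k
      exact hm1 _
  choose c x hx using key
  obtain ⟨e, he⟩ := exists_injective_nat (Σ n : ℕ, (Fin n → ℕ))
  obtain ⟨a, ha⟩ := Cardinal.infinite_pigeonhole (fun i => ULift.up.{u} (e (c i))) hι
    (by simpa using hcf)
  set S := (fun i => ULift.up.{u} (e (c i))) ⁻¹' {a} with hS
  have hSinf : ℵ₀ ≤ #S := ha ▸ hι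
  have hSi : Infinite S := Cardinal.infinite_iff.2 hSinf
  obtain ⟨i0⟩ : Nonempty S := inferInstance
  obtain ⟨⟨n, v⟩, hc⟩ : ∃ c0, ∀ i : S, c i = c0 := by
    refine ⟨c i0, fun i => he ?_⟩
    have h1 := i.2
    have h2 := i0.2
    simp only [hS, mem_preimage, mem_singleton_iff] at h1 h2
    exact ULift.up_injective (h1.trans h2.symm)
  have key2 : ∀ i : S, ∃ y : Fin n → X, ∀ j, (∀ k, F j (y k) ∈ b (v k)) ↔ j = i := by
    intro i
    have gen : ∀ (ci : Σ n : ℕ, (Fin n → ℕ)) (xi : Fin ci.1 → X), ci = ⟨n, v⟩ →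
        (∀ j, (∀ k, F j (xi k) ∈ b (ci.2 k)) ↔ j = i) →
        ∃ y : Fin n → X, ∀ j, (∀ k, F j (y k) ∈ b (v k)) ↔ j = i := by
      rintro _ xi rfl h
      exact ⟨xi, h⟩
    exact gen _ (x i) (hc i) (hx i)
  choose y hy using key2
  have hyinj : Function.Injective y := by
    intro i j hij
    have h := (hy i i).2 rfl
    rw [hij] at h
    exact Subtype.ext ((hy j i).1 h)
  refine ⟨n, ?_, ?_⟩
  · rcases Nat.eq_zero_or_pos n with rfl | h
    · exfalso
      obtain ⟨i, j, hij⟩ := exists_pair_ne S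
      exact hij (hyinj (Subsingleton.elim _ _))
    · exact h
  · have hopen : ∀ j, ∀ k, IsOpen (F j ⁻¹' b (v k)) := fun j k =>
      (hb.isOpen ⟨_, rfl⟩).preimage (hF j)
    have hd : DiscreteTopology (range y) := by
      rw [discreteTopology_iff_isOpen_singleton]
      rintro ⟨_, i, rfl⟩
      rw [isOpen_induced_iff]
      refine ⟨univ.pi fun k => F i ⁻¹' b (v k),
        isOpen_set_pi finite_univ fun k _ => hopen i k, ?_⟩
      ext ⟨_, j, rfl⟩
      simp only [mem_preimage, mem_univ_pi, mem_singleton_iff]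
      rw [Subtype.ext_iff, hy j i]
      exact ⟨fun h => congrArg y (Subtype.ext h.symm), fun h => congrArg Subtype.val (hyinj h).symm⟩
    rw [← ha, ← Cardinal.mk_range_eq y hyinj]
    exact le_ciSup (f := fun D : {D : Set (Fin n → X) // DiscreteTopology ↥D} => #↥D.1)
      Cardinal.bddAbove_of_small ⟨range y, hd⟩

theorem main_aux {X : Type u} [TopologicalSpace X] {Y : Type u} [TopologicalSpace Y] {E : Type}
    [TopologicalSpace E] [SecondCountableTopology E] [T35Space E]
    (G : Y → X → E) (hG : ∀ y, Continuous (G y)) (hind : Topology.IsInducing G)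
    (D : Set Y) (hD : DiscreteTopology D) (hι : ℵ₀ ≤ #D) (hcf : ℵ₀ < (#D).ord.cof)
    (hsep : ∀ x y, x ≠ y → ∃ d ∈ D, G d x ≠ G d y) :
    ∃ n : ℕ, 1 ≤ n ∧ iweight X ≤ #D ∧ #D ≤ spread (Fin n → X) := by
  have h1 : iweight X ≤ #D := iweight_le_aux hι (fun d : D => G d) (fun d => hG d) (by
    intro x y hxy
    obtain ⟨d, hd, h⟩ := hsep x y hxy
    exact ⟨⟨d, hd⟩, h⟩)
  obtain ⟨n, hn, h2⟩ := spread_aux hι hcf (fun d : D => G d) (fun d => hG d) (by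
    intro i
    have ho : IsOpen ({i} : Set D) := isOpen_discrete _
    obtain ⟨U, hU, hUi⟩ := (hind.comp Topology.IsInducing.subtypeVal).isOpen_iff.1 ho
    refine ⟨U, hU, fun j => ?_⟩
    have : j ∈ (G ∘ Subtype.val) ⁻¹' U ↔ j ∈ ({i} : Set D) := by rw [hUi]
    simpa using this)
  exact ⟨n, hn, h1, h2⟩

theorem inducing1 (X : Type u) [TopologicalSpace X] :
    Topology.IsInducing (fun (f : Cp X) (x : X) => f.1 x) :=
  (Topology.IsInducing.subtypeVal : Topology.IsInducing
    (Subtype.val : {f : X → ℝ // Continuous f} → X → ℝ))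

theorem inducing2 (X : Type u) [TopologicalSpace X] :
    Topology.IsInducing (fun (f : Cp X × Cp X) (x : X) => (f.1.1 x, f.2.1 x)) := by
  have h := (inducing1 X).prodMap (inducing1 X)
  have hc : Continuous (fun (f : Cp X × Cp X) (x : X) => (f.1.1 x, f.2.1 x)) := by
    have h1 := (inducing1 X).continuous
    refine continuous_pi fun x => ?_
    exact (((continuous_apply x).comp h1).comp continuous_fst).prodMk
      (((continuous_apply x).comp h1).comp continuous_snd)
  have hg : Continuous (fun (g : X → ℝ × ℝ) => ((fun x => (g x).1), (fun x => (g x).2))) := by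
    fun_prop
  exact Topology.IsInducing.of_comp hc hg h

/-- If `C_p(X)` or `C_p^2(X)` has a discrete point-separating subspace of infinite
cardinality `τ` with `cf(τ) > ω`, then `s(X^n) ≥ τ ≥ iw(X)` for some `n ≥ 1`. -/
theorem stmt2 {X : Type u} [TopologicalSpace X] [T35Space X] [Infinite X]
    (τ : Cardinal.{u}) (hτ : ℵ₀ ≤ τ) (hcf : ℵ₀ < τ.ord.cof)
    (hD : (∃ D : Set (Cp X), DiscreteTopology ↥D ∧ PointSep1 D ∧ #↥D = τ) ∨
          (∃ D : Set (Cp X × Cp X), DiscreteTopology ↥D ∧ PointSep2 D ∧ #↥D = τ)) :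
    ∃ n : ℕ, 1 ≤ n ∧ iweight X ≤ τ ∧ τ ≤ spread (Fin n → X) := by
  rcases hD with ⟨D, hd, hs, rfl⟩ | ⟨D, hd, hs, rfl⟩
  · exact main_aux _ (fun f => f.2) (inducing1 X) D hd hτ hcf hs
  · refine main_aux _ (fun f => f.1.2.prodMk f.2.2) (inducing2 X) D hd hτ hcf ?_
    intro x y hxy
    obtain ⟨p, hp, h⟩ := hs x y hxy
    refine ⟨p, hp, fun he => ?_⟩
    rcases h with h | h
    · exact h (congrArg Prod.fst he)
    · exact h (congrArg Prod.snd he)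
end

section
/- Assume the Generalized Continuum Hypothesis. Let X be an infinite Tychonoff space. If C_p^2(X) has a discrete point-separating subspace, then there exists a natural number n ≥ 1 such that s(X^n) ≥ iw(X). -/
open Cardinal Set

universe u

open Topology

theorem aux_discrete {Y : Type u} [TopologicalSpace Y] (A : Set Y)
    (h : ∀ y ∈ A, ∃ O : Set Y, IsOpen O ∧ y ∈ O ∧ ∀ z ∈ A, z ∈ O → z = y) :
    DiscreteTopology A := by
  rw [discreteTopology_iff_isOpen_singleton]
  rintro ⟨y, hy⟩
  obtain ⟨O, hO, hyO, hz⟩ := h y hy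
  refine ⟨O, hO, ?_⟩
  ext ⟨z, hzA⟩
  simp only [mem_preimage, mem_singleton_iff, Subtype.mk.injEq]
  constructor
  · exact hz z hzA
  · rintro rfl; exact hyO

theorem aux_card_le_spread {Y : Type u} [TopologicalSpace Y] (A : Set Y)
    (h : DiscreteTopology A) : #A ≤ spread Y :=
  le_ciSup (f := fun D : {D : Set Y // DiscreteTopology ↥D} => #↥D.1)
    (Cardinal.bddAbove_of_small) ⟨A, h⟩

theorem aux_aleph0_le_spread (Y : Type u) [TopologicalSpace Y] [T2Space Y] [Infinite Y] :
    ℵ₀ ≤ spread Y := by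
  obtain ⟨s, hs, hd⟩ := exists_infinite_discreteTopology Y
  have : Infinite s := hs.to_subtype
  exact (Cardinal.aleph0_le_mk s).trans (aux_card_le_spread s hd)

/-- Shapirovskii's lemma. -/
theorem aux_shap {Y : Type u} [TopologicalSpace Y] (S : Set Y) (U : Y → Set Y)
    (hU : ∀ y ∈ S, IsOpen (U y) ∧ y ∈ U y) :
    ∃ A : Set Y, A ⊆ S ∧ DiscreteTopology A ∧ S ⊆ closure A ∪ ⋃ a ∈ A, U a := by
  classical
  let r : Y → Y → Prop := WellOrderingRel
  have wf : WellFounded r := IsWellFounded.wf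
  let P : Y → Prop := wf.fix (fun y ih =>
    y ∈ S ∧ y ∉ closure {z | ∃ h : r z y, ih z h} ∧ ∀ z, ∀ h : r z y, ih z h → y ∉ U z)
  have hP : ∀ y, P y ↔
      (y ∈ S ∧ y ∉ closure {z | r z y ∧ P z} ∧ ∀ z, r z y → P z → y ∉ U z) := by
    intro y
    have : P y = _ := wf.fix_eq _ y
    rw [this]
    simp only [exists_prop]
    rfl
  refine ⟨{y | P y}, fun y hy => ((hP y).1 hy).1, ?_, ?_⟩
  · apply aux_discrete
    intro y hy
    obtain ⟨h1, h2, h3⟩ := (hP y).1 hy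
    refine ⟨U y ∩ (closure {z | r z y ∧ P z})ᶜ, (hU y h1).1.inter isClosed_closure.isOpen_compl,
      ⟨(hU y h1).2, h2⟩, ?_⟩
    rintro z hz ⟨hz1, hz2⟩
    rcases trichotomous_of r z y with h | h | h
    · exact absurd (subset_closure (show z ∈ {z | r z y ∧ P z} from ⟨h, hz⟩)) hz2
    · exact h
    · exact absurd hz1 (((hP z).1 hz).2.2 y h hy)
  · intro y hy
    by_cases hPy : P y
    · exact Or.inl (subset_closure hPy)
    · rw [hP] at hPy
      push Not at hPy
      by_cases hc : y ∈ closure {z | r z y ∧ P z}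
      · exact Or.inl (closure_mono (fun z hz => hz.2) hc)
      · obtain ⟨z, _, hz, hz'⟩ := hPy hy hc
        exact Or.inr (mem_iUnion₂.2 ⟨z, hz, hz'⟩)

theorem aux_enum {Y : Type u} [TopologicalSpace Y] {Λ : Type u} (hΛ : #Λ = spread Y)
    (A : Set Y) (hA : DiscreteTopology A) (hne : A.Nonempty) :
    ∃ e : Λ → Y, range e = A := by
  have h : #A ≤ #Λ := hΛ ▸ aux_card_le_spread A hA
  obtain ⟨f⟩ := h
  have : Nonempty A := hne.to_subtype
  refine ⟨fun i => (Function.invFun f i : A), ?_⟩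
  have hs : Function.Surjective (Function.invFun f) := Function.invFun_surjective f.injective
  ext y
  constructor
  · rintro ⟨i, rfl⟩; exact Subtype.coe_prop _
  · intro hy
    obtain ⟨i, hi⟩ := hs ⟨y, hy⟩
    exact ⟨i, by simp [hi]⟩

theorem aux_pseudo {Y : Type u} [TopologicalSpace Y] [T2Space Y] [Infinite Y]
    {Λ : Type u} (hΛ : #Λ = spread Y) :
    ∃ G : (Λ ⊕ Set Λ) → Y → Set Y, (∀ m x, IsOpen (G m x) ∧ x ∈ G m x) ∧
      ∀ x q, q ≠ x → ∃ m, q ∉ G m x := by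
  classical
  have key : ∀ x : Y, ∃ G : (Λ ⊕ Set Λ) → Set Y, (∀ m, IsOpen (G m) ∧ x ∈ G m) ∧
      ∀ q, q ≠ x → ∃ m, q ∉ G m := by
    intro x
    have h0 : ∀ y : Y, ∃ U : Set Y, y ≠ x → IsOpen U ∧ y ∈ U ∧ x ∉ closure U := by
      intro y
      by_cases hy : y = x
      · exact ⟨univ, fun h => absurd hy h⟩
      · obtain ⟨u, v, hu, hv, hyu, hxv, hd⟩ := t2_separation hy
        refine ⟨u, fun _ => ⟨hu, hyu, fun hx => ?_⟩⟩
        exact (hd.closure_left hv).le_bot ⟨hx, hxv⟩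
    choose U hU using h0
    obtain ⟨A, hAS, hAd, hcov⟩ := aux_shap {y | y ≠ x} U (fun y hy => ⟨(hU y hy).1, (hU y hy).2.1⟩)
    have hne : A.Nonempty := by
      obtain ⟨y, hy⟩ := exists_ne x
      by_contra h
      rw [not_nonempty_iff_eq_empty] at h
      subst h
      simpa using hcov hy
    obtain ⟨e, he⟩ := aux_enum hΛ A hAd hne
    let C : (Λ ⊕ Set Λ) → Set Y := Sum.elim (fun i => closure (U (e i))) (fun B => closure (e '' B))
    have hC : ∀ m, IsClosed (C m) := by
      rintro (i | B) <;> exact isClosed_closure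
    refine ⟨fun m => if x ∈ C m then univ else (C m)ᶜ, ?_, ?_⟩
    · intro m
      dsimp only
      split_ifs with h
      · exact ⟨isOpen_univ, trivial⟩
      · exact ⟨(hC m).isOpen_compl, h⟩
    · intro q hq
      have main : ∃ m, q ∈ C m ∧ x ∉ C m := by
        rcases hcov hq with h | h
        · refine ⟨Sum.inr {i | e i ∈ U q}, ?_, ?_⟩
          · change q ∈ closure (e '' {i | e i ∈ U q})
            have h1 : U q ∩ A ⊆ e '' {i | e i ∈ U q} := by
              rintro z ⟨hz, hzA⟩
              rw [← he] at hzA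
              obtain ⟨i, rfl⟩ := hzA
              exact ⟨i, hz, rfl⟩
            exact closure_mono h1 ((hU q hq).1.inter_closure ⟨(hU q hq).2.1, h⟩)
          · intro hx
            refine (hU q hq).2.2 (closure_mono ?_ hx)
            rintro _ ⟨i, hi, rfl⟩
            exact hi
        · obtain ⟨a, ha, hqa⟩ := mem_iUnion₂.1 h
          have ha' := hAS ha
          rw [← he] at ha
          obtain ⟨i, rfl⟩ := ha
          exact ⟨Sum.inl i, subset_closure hqa, (hU _ ha').2.2⟩
      obtain ⟨m, h1, h2⟩ := main
      refine ⟨m, ?_⟩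
      simp only [h2, if_false]
      exact fun h => h h1
  choose G hG using key
  exact ⟨fun m x => G x m, fun m x => (hG x).1 m, fun x q h => (hG x).2 q h⟩

/-- Hajnal–Juhász: `|Y| ≤ 2^(2^s(Y))`. -/
theorem aux_HJ (Y : Type u) [TopologicalSpace Y] [T2Space Y] [Infinite Y] :
    #Y ≤ 2 ^ (2 ^ spread Y : Cardinal.{u}) := by
  classical
  obtain ⟨Λ, hΛ⟩ : ∃ Λ : Type u, #Λ = spread Y := ⟨(spread Y).out, Cardinal.mk_out _⟩
  have hinf : ℵ₀ ≤ #Λ := hΛ ▸ aux_aleph0_le_spread Y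
  obtain ⟨G, hG, hGs⟩ := aux_pseudo hΛ
  let Lab : Type u := Filter Λ ⊕ (Λ → Λ ⊕ Set Λ)
  let ar : Option Lab → Type u := fun l => Option.elim l PEmpty (fun _ => Λ)
  let W : Type u := WType ar
  let pick : Set Y → Y := fun S => if h : S.Nonempty then h.some else Classical.arbitrary Y
  have hpick : ∀ S : Set Y, S.Nonempty → pick S ∈ S := by
    intro S hS
    simp only [pick, hS, dif_pos]
    exact hS.some_mem
  let bad : (Λ → Λ ⊕ Set Λ) → (Λ → Y) → Set Y :=
    fun m f => closure (range f) ∪ ⋃ i, G (m i) (f i)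
  let step : Lab → (Λ → Y) → Y := fun l f =>
    Sum.elim (fun F => pick {q | Filter.Tendsto f F (𝓝 q)}) (fun m => pick (bad m f)ᶜ) l
  let step' : (Σ l : Option Lab, ar l → Y) → Y := fun p =>
    match p with
    | ⟨none, _⟩ => Classical.arbitrary Y
    | ⟨some l, f⟩ => step l f
  let ev : W → Y := WType.elim Y step'
  have hev : ∀ (l : Lab) (f : Λ → W), ev (WType.mk (some l) f) = step l (fun i => ev (f i)) :=
    fun l f => rfl
  have hcl : ∀ (l : Lab) (f : Λ → Y), range f ⊆ range ev → step l f ∈ range ev := by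
    intro l f hf
    choose g hg using fun i => hf (mem_range_self i)
    refine ⟨WType.mk (some l) g, ?_⟩
    rw [hev]
    simp only [hg]
  have hsurj : Function.Surjective ev := by
    by_contra hns
    have hns' : ∃ q, q ∉ range ev := by
      simpa [Function.Surjective] using hns
    obtain ⟨q, hq⟩ := hns'
    have : ∀ x, ∃ m, x ∈ range ev → q ∉ G m x := by
      intro x
      by_cases hx : x ∈ range ev
      · obtain ⟨m, hm⟩ := hGs x q (fun h => hq (h ▸ hx))
        exact ⟨m, fun _ => hm⟩
      · obtain ⟨i⟩ : Nonempty Λ := (Cardinal.infinite_iff.2 hinf).nonempty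
        exact ⟨Sum.inl i, fun h => absurd h hx⟩
    choose m hm using this
    obtain ⟨A, hAS, hAd, hcov⟩ := aux_shap (range ev) (fun x => G (m x) x)
      (fun x _ => hG _ _)
    have hne : A.Nonempty := by
      by_contra h
      rw [not_nonempty_iff_eq_empty] at h
      subst h
      have w : W := WType.mk none (fun i => PEmpty.elim i)
      simpa using hcov (mem_range_self w)
    obtain ⟨e, he⟩ := aux_enum hΛ A hAd hne
    have her : range e ⊆ range ev := he ▸ hAS
    have hqA : q ∉ closure (range e) := by
      intro hqc
      apply hq
      have hnb : (Filter.comap e (𝓝 q)).NeBot := by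
        rw [Filter.comap_neBot_iff]
        intro t ht
        obtain ⟨y, hy, i, rfl⟩ := mem_closure_iff_nhds.1 hqc t ht
        exact ⟨i, hy⟩
      have := hcl (Sum.inl (Filter.comap e (𝓝 q))) e her
      have ht : Filter.Tendsto e (Filter.comap e (𝓝 q)) (𝓝 q) := Filter.tendsto_comap
      have hp := hpick {q' | Filter.Tendsto e (Filter.comap e (𝓝 q)) (𝓝 q')} ⟨q, ht⟩
      have hpq := tendsto_nhds_unique hp ht
      simp only [step, Sum.elim_inl] at this
      rwa [hpq] at this
    have hqb : q ∈ (bad (fun i => m (e i)) e)ᶜ := by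
      rintro (h | h)
      · exact hqA h
      · obtain ⟨i, hi⟩ := mem_iUnion.1 h
        exact hm (e i) (her (mem_range_self i)) hi
    have h1 := hpick _ ⟨q, hqb⟩
    have h2 : pick (bad (fun i => m (e i)) e)ᶜ ∈ range ev :=
      hcl (Sum.inr (fun i => m (e i))) e her
    apply h1
    rcases hcov h2 with h | h
    · left; rw [he]; exact h
    · right
      obtain ⟨a, ha, h⟩ := mem_iUnion₂.1 h
      rw [← he] at ha
      obtain ⟨i, rfl⟩ := ha
      exact mem_iUnion.2 ⟨i, h⟩
  have hW : #W ≤ 2 ^ (2 ^ #Λ : Cardinal.{u}) := by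
    apply WType.cardinalMk_le_of_le
    have h2 : #Λ ≤ 2 ^ #Λ := (Cardinal.cantor _).le
    have h3 : ℵ₀ ≤ (2 : Cardinal.{u}) ^ #Λ := hinf.trans h2
    have h4 : (2 : Cardinal.{u}) ^ #Λ ≤ 2 ^ (2 ^ #Λ : Cardinal.{u}) := (Cardinal.cantor _).le
    have h5 : ℵ₀ ≤ (2 : Cardinal.{u}) ^ (2 ^ #Λ : Cardinal.{u}) := h3.trans h4
    have hF : #(Filter Λ) ≤ 2 ^ (2 ^ #Λ : Cardinal.{u}) := by
      have : Function.Injective (fun F : Filter Λ => F.sets) := fun F F' h => Filter.ext (fun s => by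
        change s ∈ F.sets ↔ s ∈ F'.sets
        rw [show F.sets = F'.sets from h])
      have := Cardinal.mk_le_of_injective this
      simpa using this
    have hM : #(Λ → Λ ⊕ Set Λ) ≤ 2 ^ (2 ^ #Λ : Cardinal.{u}) := by
      have : #(Λ ⊕ Set Λ) ≤ 2 ^ #Λ := by
        rw [Cardinal.mk_sum, Cardinal.lift_id, Cardinal.lift_id, Cardinal.mk_set]
        exact Cardinal.add_le_of_le h3 h2 le_rfl
      rw [← Cardinal.power_def]
      calc _ ≤ ((2 : Cardinal.{u}) ^ #Λ) ^ #Λ := Cardinal.power_le_power_right this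
        _ = 2 ^ #Λ := by rw [← Cardinal.power_mul, Cardinal.mul_eq_self hinf]
        _ ≤ _ := h4
    have hL : #Lab ≤ 2 ^ (2 ^ #Λ : Cardinal.{u}) := by
      rw [Cardinal.mk_sum, Cardinal.lift_id, Cardinal.lift_id]
      exact Cardinal.add_le_of_le h5 hF hM
    have hO : #(Option Lab) ≤ 2 ^ (2 ^ #Λ : Cardinal.{u}) := by
      rw [Cardinal.mk_option]
      exact Cardinal.add_le_of_le h5 hL (Cardinal.one_le_aleph0.trans h5)
    have hS : ∀ l : Option Lab, ((2 : Cardinal.{u}) ^ (2 ^ #Λ : Cardinal.{u})) ^ #(ar l) ≤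
        ((2 : Cardinal.{u}) ^ (2 ^ #Λ : Cardinal.{u})) ^ #Λ := by
      rintro (_ | l)
      · exact Cardinal.power_le_power_left (Cardinal.aleph0_pos.trans_le h5).ne' (by simp [ar])
      · exact le_rfl
    refine (Cardinal.sum_le_sum _ _ hS).trans ?_
    rw [Cardinal.sum_const', ← Cardinal.power_mul, Cardinal.mul_eq_left h3 h2
      (Cardinal.aleph0_pos.trans_le hinf).ne']
    exact (mul_le_mul_left hO _).trans (Cardinal.mul_eq_self h5).le
  rw [← hΛ]
  exact (Cardinal.mk_le_of_surjective hsurj).trans hW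

theorem aux_t35 {X Y : Type u} [TopologicalSpace Y] [T35Space Y] (f : X → Y)
    (hf : Function.Injective f) : @T35Space X (TopologicalSpace.induced f inferInstance) := by
  letI : TopologicalSpace X := TopologicalSpace.induced f inferInstance
  exact IsEmbedding.t35Space (f := f) ⟨⟨rfl⟩, hf⟩

theorem aux_iweight_le {X I : Type u} [t : TopologicalSpace X] (f : I → X → ℝ)
    (hf : ∀ i, Continuous (f i)) (hs : ∀ x y, x ≠ y → ∃ i, f i x ≠ f i y) :
    iweight X ≤ max ℵ₀ #I := by
  classical
  let Φ : X → (I → ℝ) := fun x i => f i x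
  have hΦ : Function.Injective Φ := by
    intro x y h
    by_contra hne
    obtain ⟨i, hi⟩ := hs x y hne
    exact hi (congrFun h i)
  have hcont : Continuous Φ := continuous_pi hf
  let t' : TopologicalSpace X := TopologicalSpace.induced Φ inferInstance
  have hle : t ≤ t' := continuous_iff_le_induced.1 hcont
  have h35 : @T35Space X t' :=
    aux_t35 Φ hΦ
  refine (ciInf_le' _ (⟨t', hle, h35⟩ :
    {t' : TopologicalSpace X // t ≤ t' ∧ @T35Space X t'})).trans ?_
  let S : Set (Set X) := range (fun p : I × (TopologicalSpace.countableBasis ℝ) => f p.1 ⁻¹' p.2)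
  have hgen : t' = TopologicalSpace.generateFrom S := by
    have h1 : t' = ⨅ i, TopologicalSpace.induced (f i) inferInstance := by
      change TopologicalSpace.induced Φ (⨅ i, _) = _
      rw [induced_iInf]
      simp only [induced_compose]
      rfl
    rw [h1]
    have h2 : ∀ i, TopologicalSpace.induced (f i) inferInstance =
        TopologicalSpace.generateFrom (preimage (f i) '' TopologicalSpace.countableBasis ℝ) := by
      intro i
      exact (congrArg (TopologicalSpace.induced (f i))
        (TopologicalSpace.isBasis_countableBasis ℝ).eq_generateFrom).trans induced_generateFrom_eq
    simp only [h2]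
    rw [← generateFrom_iUnion]
    congr 1
    ext s
    simp only [mem_iUnion, mem_image, S, mem_range, Prod.exists, Subtype.exists]
    constructor
    · rintro ⟨i, b, hb, rfl⟩; exact ⟨i, b, hb, rfl⟩
    · rintro ⟨i, b, hb, rfl⟩; exact ⟨i, b, hb, rfl⟩
  have hb := @TopologicalSpace.isTopologicalBasis_of_subbasis X t' S hgen
  refine (ciInf_le' _ (⟨_, hb⟩ :
    {B : Set (Set X) // @TopologicalSpace.IsTopologicalBasis X t' B})).trans ?_
  have hS : #S ≤ max ℵ₀ #I := by
    have h1 : lift.{u} #S ≤ lift.{u} #(I × (TopologicalSpace.countableBasis ℝ)) := by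
      simpa using Cardinal.mk_range_le_lift
        (f := fun p : I × (TopologicalSpace.countableBasis ℝ) => f p.1 ⁻¹' (p.2 : Set ℝ))
    have h2 : #(TopologicalSpace.countableBasis ℝ) ≤ ℵ₀ :=
      Cardinal.mk_le_aleph0_iff.2 (TopologicalSpace.countable_countableBasis ℝ).to_subtype
    rw [Cardinal.lift_id] at h1
    refine h1.trans ?_
    rw [Cardinal.lift_id', Cardinal.mk_prod, Cardinal.lift_uzero]
    have h3 : lift.{u} #(TopologicalSpace.countableBasis ℝ) ≤ ℵ₀ := by simpa using h2
    refine (mul_le_mul' (le_max_right ℵ₀ #I) (h3.trans (le_max_left ℵ₀ #I))).trans ?_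
    rw [Cardinal.mul_eq_self (le_max_left _ _)]
  refine Cardinal.mk_image_le.trans ?_
  have hsurj : ∃ g : Finset S → {T : Set (Set X) | T.Finite ∧ T ⊆ S}, Function.Surjective g := by
    refine ⟨fun T => ⟨Subtype.val '' (T : Set S), (T.finite_toSet).image _, ?_⟩, ?_⟩
    · rintro _ ⟨s, _, rfl⟩; exact s.2
    · rintro ⟨T, hT, hTS⟩
      refine ⟨(hT.preimage (Subtype.val_injective.injOn)).toFinset, ?_⟩
      ext s
      simp only [Finite.coe_toFinset, Subtype.image_preimage_coe, mem_inter_iff]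
      exact ⟨fun h => h.2, fun h => ⟨hTS h, h⟩⟩
  obtain ⟨g, hg⟩ := hsurj
  refine (Cardinal.mk_le_of_surjective hg).trans ?_
  have h4 : #(Finset S) ≤ #(List S) :=
    Cardinal.mk_le_of_surjective (f := List.toFinset) (fun s => ⟨s.toList, by simp⟩)
  refine h4.trans ((Cardinal.mk_list_le_max _).trans ?_)
  exact max_le (le_max_left _ _) hS

theorem aux_iweight_le_card (X : Type u) [TopologicalSpace X] [T35Space X] [Infinite X] :
    iweight X ≤ #X := by
  classical
  have key : ∀ p : X × X, ∃ f : X → ℝ, Continuous f ∧ (p.1 ≠ p.2 → f p.1 ≠ f p.2) := by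
    rintro ⟨x, y⟩
    by_cases h : x = y
    · exact ⟨fun _ => 0, continuous_const, fun h' => absurd h h'⟩
    · obtain ⟨f, hf, h0, h1⟩ := CompletelyRegularSpace.completely_regular x {y}
        isClosed_singleton (by simpa using h)
      refine ⟨fun z => (f z : ℝ), continuous_subtype_val.comp hf, fun _ => ?_⟩
      have := h1 (mem_singleton y)
      simp [h0, this]
  choose f hf hs using key
  refine (aux_iweight_le f hf (fun x y h => ⟨(x, y), hs (x, y) h⟩)).trans ?_
  rw [Cardinal.mk_prod, Cardinal.lift_id, Cardinal.mul_eq_self (Cardinal.aleph0_le_mk X)]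
  exact max_le (Cardinal.aleph0_le_mk X) le_rfl

theorem aux_witness {X : Type u} [TopologicalSpace X] [Infinite X]
    (F : Set (Cp X × Cp X)) (hd : DiscreteTopology F) (p : F) :
    ∃ (j : Σ n : ℕ, (Fin (n + 1) → TopologicalSpace.countableBasis (ℝ × ℝ))),
      ∃ (x : Fin (j.1 + 1) → X),
      (∀ i, (p.1.1.1 (x i), p.1.2.1 (x i)) ∈ (j.2 i : Set (ℝ × ℝ))) ∧
      ∀ q : F, (∀ i, (q.1.1.1 (x i), q.1.2.1 (x i)) ∈ (j.2 i : Set (ℝ × ℝ))) → q = p := by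
  classical
  let Ψ : F → (X → ℝ × ℝ) := fun q x => (q.1.1.1 x, q.1.2.1 x)
  have hΨ : IsInducing Ψ := by
    have h1 : IsInducing (fun q : F => ((q.1.1.1, q.1.2.1) : (X → ℝ) × (X → ℝ))) :=
      (IsInducing.prodMap (f := fun g : Cp X => g.1) (g := fun g : Cp X => g.1)
        IsInducing.subtypeVal IsInducing.subtypeVal).comp IsInducing.subtypeVal
    have hc : Continuous (fun h : X → ℝ × ℝ => ((fun x => (h x).1, fun x => (h x).2) :
      (X → ℝ) × (X → ℝ))) := by fun_prop
    have hc' : Continuous (fun h : (X → ℝ) × (X → ℝ) => fun x => (h.1 x, h.2 x)) := by fun_prop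
    exact IsInducing.of_comp (f := Ψ) (hc'.comp h1.continuous) hc h1
  have hopen : IsOpen ({p} : Set F) := isOpen_discrete _
  obtain ⟨V, hV, hVp⟩ := hΨ.isOpen_iff.1 hopen
  have hpV : Ψ p ∈ V := by
    have : p ∈ Ψ ⁻¹' V := by rw [hVp]; rfl
    exact this
  obtain ⟨I, u, hu, hsub⟩ := isOpen_pi_iff.1 hV _ hpV
  have hO : ∀ x, ∃ O : TopologicalSpace.countableBasis (ℝ × ℝ),
      Ψ p x ∈ (O : Set (ℝ × ℝ)) ∧ (x ∈ I → (O : Set (ℝ × ℝ)) ⊆ u x) := by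
    intro x
    have hx : IsOpen (if x ∈ I then u x else univ) ∧ Ψ p x ∈ (if x ∈ I then u x else univ) := by
      split_ifs with h
      · exact hu x h
      · exact ⟨isOpen_univ, trivial⟩
    obtain ⟨O, hO, h1, h2⟩ :=
      (TopologicalSpace.isBasis_countableBasis (ℝ × ℝ)).exists_subset_of_mem_open hx.2 hx.1
    exact ⟨⟨O, hO⟩, h1, fun h => by simpa [h] using h2⟩
  choose O hO1 hO2 using hO
  let x0 : X := Classical.arbitrary X
  let J : Finset X := insert x0 I
  obtain ⟨n, hn⟩ : ∃ n, J.card = n + 1 :=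
    Nat.exists_eq_succ_of_ne_zero (Finset.card_ne_zero.2 (Finset.insert_nonempty _ _))
  let e : J ≃ Fin (n + 1) := J.equivFinOfCardEq hn
  refine ⟨⟨n, fun i => O (e.symm i).1⟩, fun i => (e.symm i).1, fun i => hO1 _, ?_⟩
  intro q hq
  have : q ∈ Ψ ⁻¹' V := by
    apply hsub
    intro x hx
    have h := hq (e ⟨x, Finset.mem_insert_of_mem hx⟩)
    simp only [Equiv.symm_apply_apply] at h
    exact hO2 x hx h
  rw [hVp] at this
  exact this

theorem aux_card_F {X : Type u} [TopologicalSpace X] [Infinite X]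
    (F : Set (Cp X × Cp X)) (hd : DiscreteTopology F) (μ : Cardinal.{u}) (hμ : ℵ₀ ≤ μ)
    (h : ∀ n : ℕ, spread (Fin (n + 1) → X) ≤ μ) : #F ≤ μ := by
  classical
  choose k hk using aux_witness F hd
  let J := Σ n : ℕ, (Fin (n + 1) → TopologicalSpace.countableBasis (ℝ × ℝ))
  have : Countable (TopologicalSpace.countableBasis (ℝ × ℝ)) :=
    (TopologicalSpace.countable_countableBasis (ℝ × ℝ)).to_subtype
  have hJ : Countable J := inferInstance
  let c : F → ULift.{u} J := fun p => ⟨k p⟩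
  have hfib : ∀ j : ULift.{u} J, #(c ⁻¹' {j}) ≤ μ := by
    rintro ⟨⟨m, Q⟩⟩
    have hx : ∀ p : c ⁻¹' {⟨⟨m, Q⟩⟩}, ∃ y : Fin (m + 1) → X,
        (∀ i, (p.1.1.1.1 (y i), p.1.1.2.1 (y i)) ∈ (Q i : Set (ℝ × ℝ))) ∧
        ∀ q : F, (∀ i, (q.1.1.1 (y i), q.1.2.1 (y i)) ∈ (Q i : Set (ℝ × ℝ))) → q = p.1 := by
      rintro ⟨p, hp⟩
      have hp' : k p = ⟨m, Q⟩ := congrArg ULift.down hp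
      have h1 := hk p
      rw [hp'] at h1
      exact h1
    choose y hy hyu using hx
    have hinj : Function.Injective y := by
      intro p q hpq
      have := hyu q p.1 (by rw [← hpq]; exact hy p)
      exact Subtype.ext this
    have hdisc : DiscreteTopology (range y) := by
      apply aux_discrete
      rintro _ ⟨p, rfl⟩
      refine ⟨⋂ i, {z | (p.1.1.1.1 (z i), p.1.1.2.1 (z i)) ∈ (Q i : Set (ℝ × ℝ))}, ?_, ?_, ?_⟩
      · refine isOpen_iInter_of_finite (fun i => ?_)
        have ho : IsOpen (Q i : Set (ℝ × ℝ)) :=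
          TopologicalSpace.isOpen_of_mem_countableBasis (Q i).2
        refine ho.preimage ?_
        exact ((p.1.1.1.2).comp (continuous_apply i)).prodMk
          ((p.1.1.2.2).comp (continuous_apply i))
      · exact mem_iInter.2 (hy p)
      · rintro _ ⟨q, rfl⟩ hz
        have := hyu q p.1 (mem_iInter.1 hz)
        rw [Subtype.ext this]
    rw [← Cardinal.mk_range_eq y hinj]
    exact (aux_card_le_spread _ hdisc).trans (h m)
  rw [← Cardinal.mk_congr (Equiv.sigmaFiberEquiv c)]
  rw [Cardinal.mk_sigma]
  refine (Cardinal.sum_le_sum _ (fun _ => μ) hfib).trans ?_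
  rw [Cardinal.sum_const']
  refine (mul_le_mul_left (Cardinal.mk_le_aleph0.trans hμ) _).trans ?_
  rw [Cardinal.mul_eq_self hμ]

/-- (GCH) If `C_p^2(X)` has a discrete point-separating subspace, then
`s(X^n) ≥ iw(X)` for some `n ≥ 1`. -/
theorem stmt4 {X : Type u} [TopologicalSpace X] [T35Space X] [Infinite X]
    (gch : ∀ κ : Cardinal.{u}, ℵ₀ ≤ κ → 2 ^ κ = Order.succ κ)
    (hF : ∃ F : Set (Cp X × Cp X), DiscreteTopology ↥F ∧ PointSep2 F) :
    ∃ n : ℕ, 1 ≤ n ∧ iweight X ≤ spread (Fin n → X) := by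
  obtain ⟨F, hd, hsep⟩ := hF
  by_contra hcon
  push Not at hcon
  have hlt : ∀ n : ℕ, spread (Fin (n + 1) → X) < iweight X := fun n => hcon _ (by omega)
  have h0 : ℵ₀ ≤ spread (Fin (0 + 1) → X) := aux_aleph0_le_spread _
  have hF1 : iweight X ≤ max ℵ₀ #(F ⊕ F) :=
    aux_iweight_le (I := F ⊕ F) (Sum.elim (fun p => p.1.1.1) (fun p => p.1.2.1))
      (by rintro (p | p); exacts [p.1.1.2, p.1.2.2])
      (fun x y h => by
        obtain ⟨p, hp, h | h⟩ := hsep x y h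
        · exact ⟨Sum.inl ⟨p, hp⟩, h⟩
        · exact ⟨Sum.inr ⟨p, hp⟩, h⟩)
  have hle : ∀ μ : Cardinal.{u}, ℵ₀ ≤ μ → (∀ n : ℕ, spread (Fin (n + 1) → X) ≤ μ) →
      iweight X ≤ μ := by
    intro μ hμ h
    have hc := aux_card_F F hd μ hμ h
    refine hF1.trans (max_le hμ ?_)
    rw [Cardinal.mk_sum, Cardinal.lift_id]
    exact Cardinal.add_le_of_le hμ hc hc
  -- successors below `iweight X` stay below
  have hsucc : ∀ μ : Cardinal.{u}, ℵ₀ ≤ μ → μ < iweight X → Order.succ μ < iweight X := by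
    intro μ hμ h
    refine lt_of_le_of_ne (Order.succ_le_of_lt h) (fun heq => ?_)
    refine absurd (hle μ hμ (fun n => ?_)) (not_le.2 h)
    have := hlt n
    rw [← heq] at this
    exact Order.lt_succ_iff.1 this
  have hs1 := hsucc _ h0 (hlt 0)
  have h1 := h0.trans (Order.le_succ _)
  have hs2 := hsucc _ h1 hs1
  have hHJ := aux_HJ (Fin (0 + 1) → X)
  rw [gch _ h0, gch _ h1] at hHJ
  have hX : #X ≤ #(Fin (0 + 1) → X) :=
    Cardinal.mk_le_of_injective (f := fun x _ => x) (fun x y h => congrFun h 0)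
  exact absurd (aux_iweight_le_card X) (not_le.2 ((hX.trans hHJ).trans_lt hs2))
end

section
/- Let X be an infinite Tychonoff space. If some finite power X^n (n ≥ 1) has a discrete subspace of cardinality iw(X), then C_p^2(X) has a point-separating discrete subspace. -/
open Cardinal Set

universe u

theorem aux_sep0 (X : Type u) [TopologicalSpace X] [T35Space X] [Infinite X]
    (B : Set (Set X)) (hB : TopologicalSpace.IsTopologicalBasis B) :
    ℵ₀ ≤ #B ∧ ∃ (ι : Type u) (g : ι → X → ℝ), #ι ≤ #B ∧
      (∀ i, Continuous (g i)) ∧ (∀ i x, 0 ≤ g i x ∧ g i x ≤ 1) ∧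
      ∀ x y, x ≠ y → ∃ i, g i x ≠ g i y := by
  have key : ∀ x y : X, x ≠ y → ∃ V ∈ B, x ∈ V ∧ y ∉ V := by
    intro x y hxy
    have ho : IsOpen ({y}ᶜ : Set X) := isOpen_compl_singleton
    obtain ⟨V, hV, hxV, hVs⟩ := hB.exists_subset_of_mem_open
      (show x ∈ ({y}ᶜ : Set X) from hxy) ho
    exact ⟨V, hV, hxV, fun h => hVs h rfl⟩
  have hinf : Infinite B := by
    by_contra hfin
    have : Finite B := not_infinite_iff_finite.mp hfin
    have hinj : Function.Injective (fun x : X => {V : B | x ∈ V.1}) := by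
      intro x y hxy
      by_contra hne
      obtain ⟨V, hV, hx, hy⟩ := key x y hne
      have : (⟨V, hV⟩ : B) ∈ {V : B | y ∈ V.1} := by
        rw [← show {V : B | x ∈ V.1} = {V : B | y ∈ V.1} from hxy]
        exact hx
      exact hy this
    have := Finite.of_injective _ hinj
    exact not_finite X
  have hal : ℵ₀ ≤ #B := Cardinal.aleph0_le_mk B
  refine ⟨hal, B × B, ?_⟩
  have hg : ∀ p : B × B, ∃ g : X → ℝ, Continuous g ∧ (∀ x, 0 ≤ g x ∧ g x ≤ 1) ∧
      ((∃ g' : X → ℝ, Continuous g' ∧ (∀ x, 0 ≤ g' x ∧ g' x ≤ 1) ∧ (∀ x ∈ p.1.1, g' x = 0) ∧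
        ∀ x, x ∉ p.2.1 → g' x = 1) → (∀ x ∈ p.1.1, g x = 0) ∧ ∀ x, x ∉ p.2.1 → g x = 1) := by
    intro p
    by_cases h : (∃ g' : X → ℝ, Continuous g' ∧ (∀ x, 0 ≤ g' x ∧ g' x ≤ 1) ∧
        (∀ x ∈ p.1.1, g' x = 0) ∧ ∀ x, x ∉ p.2.1 → g' x = 1)
    · obtain ⟨g, h1, h2, h3⟩ := h
      exact ⟨g, h1, h2, fun _ => h3⟩
    · exact ⟨fun _ => 0, continuous_const, fun _ => by simp, fun h' => absurd h' h⟩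
  choose g hgc hg01 hgs using hg
  refine ⟨g, ?_, hgc, hg01, ?_⟩
  · simp [Cardinal.mul_eq_self hal]
  · intro x y hxy
    obtain ⟨V, hV, hxV, hyV⟩ := key x y hxy
    have hVo : IsOpen V := hB.isOpen hV
    obtain ⟨f, hfc, hfx, hf1⟩ := CompletelyRegularSpace.completely_regular_isOpen x V hVo hxV
    have hfc' : Continuous (fun z => (f z : ℝ)) :=
      continuous_subtype_val.comp hfc
    have hUo : IsOpen ((fun z => (f z : ℝ)) ⁻¹' Set.Iio (1/2)) :=
      isOpen_Iio.preimage hfc'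
    obtain ⟨U, hU, hxU, hUs⟩ := hB.exists_subset_of_mem_open
      (show x ∈ ((fun z => (f z : ℝ)) ⁻¹' Set.Iio (1/2)) by simp [hfx]) hUo
    have := hgs (⟨U, hU⟩, ⟨V, hV⟩) ⟨fun z => max 0 (2 * (f z : ℝ) - 1), by fun_prop, ?_, ?_, ?_⟩
    · refine ⟨(⟨U, hU⟩, ⟨V, hV⟩), ?_⟩
      rw [this.1 x hxU, this.2 y hyV]
      exact zero_ne_one
    · intro z
      have := (f z).2.2
      exact ⟨le_max_left _ _, max_le (by norm_num) (by linarith)⟩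
    · intro z hz
      have : (f z : ℝ) < 1 / 2 := hUs hz
      exact max_eq_left (by linarith)
    · intro z hz
      have : f z = 1 := hf1 hz
      simp [this]; norm_num

theorem aux_sep (X : Type u) [t : TopologicalSpace X] [T35Space X] [Infinite X] :
    ℵ₀ ≤ iweight X ∧ ∃ (ι : Type u) (g : ι → X → ℝ), #ι ≤ iweight X ∧
      (∀ i, Continuous (g i)) ∧ (∀ i x, 0 ≤ g i x ∧ g i x ≤ 1) ∧
      ∀ x y, x ≠ y → ∃ i, g i x ≠ g i y := by
  have : Nonempty {t' : TopologicalSpace X // t ≤ t' ∧ @T35Space X t'} :=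
    ⟨⟨t, le_rfl, inferInstance⟩⟩
  obtain ⟨⟨t', htt', hT⟩, ht'⟩ := ciInf_mem
    (fun t' : {t' : TopologicalSpace X // t ≤ t' ∧ @T35Space X t'} => @weight X t'.1)
  have : Nonempty {B : Set (Set X) // @TopologicalSpace.IsTopologicalBasis X t' B} :=
    ⟨⟨_, @TopologicalSpace.isTopologicalBasis_opens X t'⟩⟩
  obtain ⟨⟨B, hB⟩, hBc⟩ := ciInf_mem
    (fun B : {B : Set (Set X) // @TopologicalSpace.IsTopologicalBasis X t' B} => #↥B.1)
  have hcard : #B = @iweight X t := by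
    have h1 : #B = @weight X t' := hBc
    have h2 : @weight X t' = @iweight X t := ht'
    rw [h1, h2]
  obtain ⟨h1, ι, g, h2, h3, h4⟩ := @aux_sep0 X t' hT _ B hB
  rw [hcard] at h1 h2
  exact ⟨h1, ι, g, h2, fun i => continuous_le_dom htt' (h3 i), h4⟩

theorem aux_star {X : Type u} [TopologicalSpace X] [T35Space X] {n : ℕ} (d : Fin n → X)
    (r : Fin n → Fin n) (hr1 : ∀ i, d (r i) = d i) (hr2 : ∀ i j, d i = d j → r i = r j)
    (W : Set (Fin n → X)) (hW : IsOpen W) (hdW : d ∈ W) :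
    ∃ f₁ f₂ : X → ℝ, Continuous f₁ ∧ Continuous f₂ ∧ (∀ i, f₁ (d i) = 1) ∧
      (∀ i, f₂ (d i) = (r i : ℕ)) ∧
      ∀ y : Fin n → X, (∀ i, |f₁ (y i) - 1| < 1 / (2 * (n + 1)) ∧
        |f₂ (y i) - (r i : ℕ)| < 1 / (2 * (n + 1))) → y ∈ W := by
  classical
  obtain ⟨N, hN, hNW⟩ := (isOpen_pi_iff'.1 hW) d hdW
  obtain ⟨U, hU, hUd⟩ := (Set.finite_range d).t2_separation
  let O : Fin n → Set X := fun i => U (d i) ∩ ⋂ j ∈ {j | d j = d i}, N j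
  have hOo : ∀ i, IsOpen (O i) := fun i => (hU (d i)).2.inter
    ((Set.toFinite _).isOpen_biInter fun j _ => (hN j).1)
  have hdO : ∀ i, d i ∈ O i := by
    intro i
    refine ⟨(hU (d i)).1, ?_⟩
    simp only [Set.mem_iInter]
    intro j hj
    have hj' : d j = d i := hj
    rw [← hj']
    exact (hN j).2
  have hON : ∀ i j, d j = d i → O i ⊆ N j := by
    intro i j hij x hx
    have := hx.2
    simp only [Set.mem_iInter] at this
    exact this j hij
  have hφ : ∀ i, ∃ φ : X → ℝ, Continuous φ ∧ φ (d i) = 1 ∧ (∀ x, x ∉ O i → φ x = 0) ∧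
      ∀ x, 0 ≤ φ x ∧ φ x ≤ 1 := by
    intro i
    obtain ⟨f, hf, hfx, hf1⟩ := CompletelyRegularSpace.completely_regular_isOpen (d i) (O i)
      (hOo i) (hdO i)
    refine ⟨fun x => 1 - (f x : ℝ), by fun_prop, by simp [hfx], ?_, ?_⟩
    · intro x hx
      have : f x = 1 := hf1 hx
      simp [this]
    · intro x
      have h1 := (f x).2.1
      have h2 := (f x).2.2
      constructor <;> linarith
  choose φ hφc hφ1 hφ0 hφ01 using hφ
  let R : Finset (Fin n) := Finset.univ.filter fun i => r i = i
  have hrr : ∀ i, r i ∈ R := by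
    intro i
    simp only [R, Finset.mem_filter, Finset.mem_univ, true_and]
    exact hr2 _ _ (hr1 i)
  have hRdis : ∀ i ∈ R, ∀ j ∈ R, i ≠ j → ∀ x, x ∈ O i → φ j x = 0 := by
    intro i hi j hj hij x hx
    apply hφ0
    intro hxj
    have hne : d i ≠ d j := by
      intro h
      have := hr2 _ _ h
      simp only [R, Finset.mem_filter, Finset.mem_univ, true_and] at hi hj
      rw [hi, hj] at this
      exact hij this
    exact Set.disjoint_left.1 (hUd (Set.mem_range_self i) (Set.mem_range_self j) hne) hx.1 hxj.1
  have hf1 : ∀ i ∈ R, ∀ x ∈ O i, ∑ j ∈ R, φ j x = φ i x := by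
    intro i hi x hx
    exact Finset.sum_eq_single i (fun j hj hji => hRdis i hi j hj hji.symm x hx)
      (fun h => absurd hi h)
  have hf2 : ∀ i ∈ R, ∀ x ∈ O i, ∑ j ∈ R, φ j x * ((j : ℕ) : ℝ) = φ i x * ((i : ℕ) : ℝ) := by
    intro i hi x hx
    exact Finset.sum_eq_single i (fun j hj hji => by rw [hRdis i hi j hj hji.symm x hx, zero_mul])
      (fun h => absurd hi h)
  refine ⟨fun x => ∑ j ∈ R, φ j x, fun x => ∑ j ∈ R, φ j x * ((j : ℕ) : ℝ),
    by fun_prop, by fun_prop, ?_, ?_, ?_⟩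
  · intro i
    have := hf1 (r i) (hrr i) (d (r i)) (hdO _)
    rw [hφ1, hr1] at this
    exact this
  · intro i
    have := hf2 (r i) (hrr i) (d (r i)) (hdO _)
    rw [hφ1, hr1, one_mul] at this
    exact this
  · intro y hy
    apply hNW
    intro i _
    obtain ⟨h1, h2⟩ := hy i
    beta_reduce at h1 h2
    have hn : (0 : ℝ) < n + 1 := by positivity
    set η : ℝ := 1 / (2 * (n + 1)) with hη
    have hηn : η * (n + 1) = 1 / 2 := by rw [hη]; field_simp
    have hη0 : 0 < η := by positivity
    have hηle : η ≤ 1 / 2 := by nlinarith [Nat.cast_nonneg (α := ℝ) n]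
    by_cases hex : ∃ k ∈ R, y i ∈ O k
    · obtain ⟨k, hk, hyk⟩ := hex
      rw [hf1 k hk _ hyk] at h1
      rw [hf2 k hk _ hyk] at h2
      have ht := hφ01 k (y i)
      set t := φ k (y i)
      rw [abs_lt] at h1 h2
      have hkn : ((k : ℕ) : ℝ) + 1 ≤ n := by exact_mod_cast k.2
      have hk0 : (0 : ℝ) ≤ ((k : ℕ) : ℝ) := Nat.cast_nonneg _
      have hb : (1 - t) * ((k : ℕ) : ℝ) ≤ η * n := by
        apply mul_le_mul <;> linarith
      have hb0 : 0 ≤ (1 - t) * ((k : ℕ) : ℝ) := mul_nonneg (by linarith) hk0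
      have hu : ((k : ℕ) : ℝ) < ((r i : ℕ) : ℝ) + 1 := by nlinarith
      have hl : ((r i : ℕ) : ℝ) < ((k : ℕ) : ℝ) + 1 := by nlinarith
      have hu' : (k : ℕ) < (r i : ℕ) + 1 := by exact_mod_cast hu
      have hl' : (r i : ℕ) < (k : ℕ) + 1 := by exact_mod_cast hl
      have hkr : k = r i := Fin.ext (by omega)
      rw [hkr] at hyk
      exact hON (r i) i (hr1 i).symm hyk
    · exfalso
      have : ∑ j ∈ R, φ j (y i) = 0 :=
        Finset.sum_eq_zero fun j hj => hφ0 j _ fun h => hex ⟨j, hj, h⟩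
      rw [this] at h1
      norm_num at h1
      linarith

theorem Cp_continuous_eval {X : Type u} [TopologicalSpace X] (x : X) :
    Continuous (fun f : Cp X => f.1 x) :=
  (continuous_apply x).comp (continuous_subtype_val (p := fun f : X → ℝ => Continuous f))

instance Cp_t2 (X : Type u) [TopologicalSpace X] : T2Space (Cp X) :=
  inferInstanceAs (T2Space {f : X → ℝ // Continuous f})

theorem aux_pattern {X : Type u} {n : ℕ} (d : Fin n → X) :
    ∃ r : Fin n → Fin n, (∀ i, d (r i) = d i) ∧ (∀ i j, d i = d j → r i = r j) := by
  classical
  by_cases hn : Nonempty (Fin n)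
  · exact ⟨fun i => Function.invFun d (d i), fun i => Function.invFun_eq ⟨i, rfl⟩,
      fun i j h => by simp only [h]⟩
  · exact ⟨id, fun _ => rfl, fun i => absurd ⟨i⟩ hn⟩

theorem aux_discrete_s5 {Y : Type u} [TopologicalSpace Y] [T1Space Y] (F : Set Y)
    (h : ∀ x ∈ F, ∃ W, IsOpen W ∧ x ∈ W ∧ (W ∩ F).Finite) : DiscreteTopology F := by
  rw [discreteTopology_iff_isOpen_singleton]
  rintro ⟨x, hx⟩
  obtain ⟨W, hWo, hxW, hfin⟩ := h x hx
  refine ⟨W ∩ ((W ∩ F) \ {x})ᶜ, hWo.inter (hfin.subset Set.sdiff_subset).isClosed.isOpen_compl, ?_⟩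
  ext ⟨y, hy⟩
  simp only [Set.mem_preimage, Set.mem_inter_iff, Set.mem_compl_iff, Set.mem_sdiff,
    Set.mem_singleton_iff, Subtype.mk.injEq]
  constructor
  · rintro ⟨h1, h2⟩
    by_contra h3
    exact h2 ⟨⟨h1, hy⟩, h3⟩
  · rintro rfl
    exact ⟨hxW, fun h => h.2 rfl⟩

/-- If some finite power `X^n` (`n ≥ 1`) has a discrete subspace of cardinality `iw(X)`,
then `C_p^2(X)` has a point-separating discrete subspace. -/
theorem stmt5 {X : Type u} [TopologicalSpace X] [T35Space X] [Infinite X]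
    (hD : ∃ n : ℕ, 1 ≤ n ∧ ∃ D : Set (Fin n → X), DiscreteTopology ↥D ∧ #↥D = iweight X) :
    ∃ F : Set (Cp X × Cp X), DiscreteTopology ↥F ∧ PointSep2 F := by
  obtain ⟨n, -, D, hDd, hDc⟩ := hD
  obtain ⟨hal, ι, g, hιc, hgc, hg01, hgs⟩ := aux_sep X
  -- pigeonhole on coincidence patterns
  let pat : D → ULift.{u} (Fin n → Fin n) := fun d => ⟨(aux_pattern d.1).choose⟩
  have hinf : ℵ₀ ≤ #D := hDc ▸ hal
  obtain ⟨⟨r⟩, hr⟩ := Cardinal.infinite_pigeonhole pat hinf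
    (lt_of_lt_of_le (Cardinal.lt_aleph0_of_finite _)
      (Ordinal.aleph0_le_cof.2 (Cardinal.isSuccLimit_ord hinf)))
  have hle : #ι ≤ #(pat ⁻¹' {⟨r⟩}) := by rw [hr, hDc]; exact hιc
  obtain ⟨e⟩ := (Cardinal.le_def _ _).1 hle
  have her : ∀ p, (∀ i, (e p).1.1 (r i) = (e p).1.1 i) ∧
      (∀ i j, (e p).1.1 i = (e p).1.1 j → r i = r j) := by
    intro p
    have h1 : pat (e p).1 = ⟨r⟩ := (e p).2
    have h2 : (aux_pattern (e p).1.1).choose = r := congrArg ULift.down h1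
    have h3 := (aux_pattern (e p).1.1).choose_spec
    rw [h2] at h3
    exact h3
  have hW : ∀ p, ∃ W : Set (Fin n → X), IsOpen W ∧ (e p).1.1 ∈ W ∧
      ∀ q, (e q).1.1 ∈ W → q = p := by
    intro p
    obtain ⟨W, hWo, hWe⟩ := (discreteTopology_iff_isOpen_singleton.1 hDd) (e p).1
    refine ⟨W, hWo, ?_, ?_⟩
    · have : (e p).1 ∈ Subtype.val ⁻¹' W := by rw [hWe]; rfl
      exact this
    · intro q hq
      have : (e q).1 ∈ Subtype.val ⁻¹' W := hq
      rw [hWe] at this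
      exact e.injective (Subtype.ext this)
  choose W hWo hWm hWu using hW
  have hst := fun p => aux_star (e p).1.1 r (her p).1 (her p).2 (W p) (hWo p) (hWm p)
  choose f₁ f₂ hf₁c hf₂c hf₁ hf₂ hf using hst
  obtain ⟨η, hη⟩ : ∃ η : ℝ, η = 1 / (2 * (n + 1)) := ⟨_, rfl⟩
  have hη0 : 0 < η := by rw [hη]; positivity
  simp only [← hη] at hf
  let ε : Bool → ℝ := fun b => if b then η / 4 else 0
  have hε : ∀ b, 0 ≤ ε b ∧ ε b ≤ η / 4 := by
    intro b
    cases b <;> simp [ε] <;> linarith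
  have hεg : ∀ b p x, 0 ≤ ε b * g p x ∧ ε b * g p x ≤ η / 4 := by
    intro b p x
    refine ⟨mul_nonneg (hε b).1 (hg01 p x).1, ?_⟩
    have := mul_le_mul (hε b).2 (hg01 p x).2 (hg01 p x).1 (by linarith : 0 ≤ η / 4)
    linarith
  let h : ι × Bool → Cp X × Cp X := fun pb =>
    (⟨fun x => f₁ pb.1 x + ε pb.2 * g pb.1 x,
      (hf₁c pb.1).add (continuous_const.mul (hgc pb.1))⟩, ⟨f₂ pb.1, hf₂c pb.1⟩)
  refine ⟨Set.range h, aux_discrete_s5 _ ?_, ?_⟩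
  · rintro _ ⟨⟨p, b⟩, rfl⟩
    refine ⟨⋂ i : Fin n, {w : Cp X × Cp X | |w.1.1 ((e p).1.1 i) - 1| < η / 2 ∧
      |w.2.1 ((e p).1.1 i) - (r i : ℕ)| < η / 2}, ?_, ?_, ?_⟩
    · refine isOpen_iInter_of_finite fun i => ?_
      have c1 := (Cp_continuous_eval ((e p).1.1 i)).comp (continuous_fst (X := Cp X) (Y := Cp X))
      have c2 := (Cp_continuous_eval ((e p).1.1 i)).comp (continuous_snd (X := Cp X) (Y := Cp X))
      exact (isOpen_lt ((c1.sub continuous_const).abs) continuous_const).inter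
        (isOpen_lt ((c2.sub continuous_const).abs) continuous_const)
    · rw [Set.mem_iInter]
      intro i
      have h1 := hεg b p ((e p).1.1 i)
      refine ⟨?_, ?_⟩
      · show |f₁ p ((e p).1.1 i) + ε b * g p ((e p).1.1 i) - 1| < η / 2
        rw [hf₁, abs_lt]
        constructor <;> linarith
      · show |f₂ p ((e p).1.1 i) - (r i : ℕ)| < η / 2
        rw [hf₂, sub_self, abs_zero]
        linarith
    · refine (Set.toFinite (h '' (Set.range fun b : Bool => (p, b)))).subset ?_
      rintro _ ⟨hw, ⟨⟨q, b'⟩, rfl⟩⟩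
      rw [Set.mem_iInter] at hw
      have hpq : p = q := by
        apply hWu q p
        apply hf q
        intro i
        obtain ⟨h1, h2⟩ := hw i
        have h1' : |f₁ q ((e p).1.1 i) + ε b' * g q ((e p).1.1 i) - 1| < η / 2 := h1
        have h2' : |f₂ q ((e p).1.1 i) - (r i : ℕ)| < η / 2 := h2
        have h3 := hεg b' q ((e p).1.1 i)
        refine ⟨?_, by linarith⟩
        rw [abs_lt] at h1' ⊢
        constructor <;> linarith
      subst hpq
      exact ⟨(p, b'), ⟨b', rfl⟩, rfl⟩
  · intro x y hxy
    obtain ⟨p, hp⟩ := hgs x y hxy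
    by_cases hfp : f₁ p x = f₁ p y
    · refine ⟨h (p, true), ⟨_, rfl⟩, Or.inl ?_⟩
      show f₁ p x + ε true * g p x ≠ f₁ p y + ε true * g p y
      rw [hfp]
      intro hc
      have hc' := add_left_cancel hc
      have : ε true ≠ 0 := by simp only [ε, if_true]; positivity
      exact hp (mul_left_cancel₀ this hc')
    · refine ⟨h (p, false), ⟨_, rfl⟩, Or.inl ?_⟩
      show f₁ p x + ε false * g p x ≠ f₁ p y + ε false * g p y
      simpa [ε] using hfp
end

section
/- Assume the Generalized Continuum Hypothesis. Let X be an infinite Tychonoff space. Then C_p^2(X) has a point-separating discrete subspace if and only if s(X^n) ≥ iw(X) for some natural number n ≥ 1. -/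
open Cardinal Set

universe u

theorem range_discrete {ι Y : Type*} [TopologicalSpace Y] (d : ι → Y) (O : ι → Set Y)
    (hO : ∀ i, IsOpen (O i)) (hm : ∀ i, d i ∈ O i) (hi : ∀ i j, d j ∈ O i → j = i) :
    DiscreteTopology ↥(Set.range d) := by
  rw [← isDiscrete_iff_discreteTopology, isDiscrete_iff_forall_mem_exists_isOpen]
  rintro _ ⟨i, rfl⟩
  refine ⟨O i, hO i, ?_⟩
  ext y
  constructor
  · rintro ⟨h, j, rfl⟩
    rw [hi i j h]; rfl
  · rintro rfl
    exact ⟨hm i, i, rfl⟩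

theorem discrete_nhd {Y : Type*} [TopologicalSpace Y] (D : Set Y) (hD : DiscreteTopology ↥D)
    (x : Y) (hx : x ∈ D) : ∃ U, IsOpen U ∧ x ∈ U ∧ ∀ y ∈ D, y ∈ U → y = x := by
  rw [← isDiscrete_iff_discreteTopology, isDiscrete_iff_forall_mem_exists_isOpen] at hD
  obtain ⟨U, hU, h⟩ := hD x hx
  refine ⟨U, hU, ?_, fun y hy hyU => ?_⟩
  · have : x ∈ U ∩ D := by rw [h]; rfl
    exact this.1
  · have : y ∈ U ∩ D := ⟨hyU, hy⟩
    rw [h] at this; exact this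

theorem le_spread_set {Y : Type u} [TopologicalSpace Y] (D : Set Y) (hD : DiscreteTopology ↥D) :
    #↥D ≤ spread Y :=
  le_ciSup (f := fun D : {D : Set Y // DiscreteTopology ↥D} => #↥D.1)
    Cardinal.bddAbove_of_small ⟨D, hD⟩

theorem le_spread {ι Y : Type u} [TopologicalSpace Y] (d : ι → Y) (O : ι → Set Y)
    (hO : ∀ i, IsOpen (O i)) (hm : ∀ i, d i ∈ O i) (hi : ∀ i j, d j ∈ O i → j = i) :
    #ι ≤ spread Y := by
  have inj : Function.Injective d := fun i j h => (hi j i (h ▸ hm j))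
  rw [← Cardinal.mk_range_eq d inj]
  exact le_spread_set _ (range_discrete d O hO hm hi)

theorem exists_of_lt_spread {Y : Type u} [TopologicalSpace Y] {c : Cardinal.{u}}
    (h : c < spread Y) : ∃ D : Set Y, DiscreteTopology ↥D ∧ c < #↥D := by
  have : Nonempty {D : Set Y // DiscreteTopology ↥D} :=
    ⟨⟨∅, inferInstance⟩⟩
  obtain ⟨D, hD⟩ := exists_lt_of_lt_ciSup h
  exact ⟨D.1, D.2, hD⟩

theorem iw_le {X : Type u} [t : TopologicalSpace X] {ι : Type u} (g : ι → X → ℝ)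
    (hg : ∀ i, Continuous (g i)) (sep : ∀ x y, x ≠ y → ∃ i, g i x ≠ g i y) :
    iweight X ≤ max #ι ℵ₀ := by
  let t' : TopologicalSpace X := TopologicalSpace.induced (fun x i => g i x) inferInstance
  have hle : t ≤ t' := by
    exact continuous_iff_le_induced.1 (@continuous_pi X ι (fun _ => ℝ) t _ (fun x i => g i x) hg)
  have h35 : @T35Space X t' := by
    refine Topology.IsEmbedding.t35Space (f := fun x i => g i x) ⟨⟨rfl⟩, ?_⟩
    intro x y h
    by_contra hne
    obtain ⟨i, hi⟩ := sep x y hne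
    exact hi (congrFun h i)
  let S : Set (Set X) := ⋃ i, Set.preimage (g i) '' TopologicalSpace.countableBasis ℝ
  have hS : t' = TopologicalSpace.generateFrom S := by
    show TopologicalSpace.induced _ (⨅ i, _) = _
    rw [induced_iInf, generateFrom_iUnion]
    congr 1
    funext i
    rw [induced_compose, ← induced_generateFrom_eq,
      ← (TopologicalSpace.isBasis_countableBasis ℝ).eq_generateFrom]
    rfl
  have hb := @TopologicalSpace.isTopologicalBasis_of_subbasis X t' S hS
  have hcS : #↥S ≤ max #ι ℵ₀ := by
    refine (Cardinal.mk_iUnion_le _).trans ?_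
    refine (mul_le_mul' le_rfl (ciSup_le' (a := ℵ₀) ?_)).trans ?_
    · intro i
      exact Cardinal.mk_le_aleph0_iff.2
        ((TopologicalSpace.countable_countableBasis ℝ).image _).to_subtype
    · exact (Cardinal.mul_le_max _ _).trans (by simp)
  have hcB : #↥((fun f : Set (Set X) => ⋂₀ f) '' { f : Set (Set X) | f.Finite ∧ f ⊆ S })
      ≤ max #ι ℵ₀ := by
    have : ((fun f : Set (Set X) => ⋂₀ f) '' { f : Set (Set X) | f.Finite ∧ f ⊆ S }) ⊆
        Set.range (fun l : List ↥S => ⋂₀ {s | ∃ a ∈ l, a.1 = s}) := by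
      rintro _ ⟨f, ⟨hf, hfS⟩, rfl⟩
      lift f to Finset (Set X) using hf
      refine ⟨f.toList.attach.map fun a => ⟨a.1, hfS (by simpa using a.2)⟩, ?_⟩
      show ⋂₀ _ = ⋂₀ _
      refine congrArg sInter ?_
      ext s
      have := @hfS s
      simp only [List.mem_map, List.mem_attach, true_and, mem_ofPred_eq, Finset.mem_coe]
      constructor
      · rintro ⟨_, ⟨a, rfl⟩, rfl⟩
        simpa using a.2
      · intro hs
        exact ⟨_, ⟨⟨s, by simpa using hs⟩, rfl⟩, rfl⟩
    refine (Cardinal.mk_le_mk_of_subset this).trans (Cardinal.mk_range_le.trans ?_)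
    refine (Cardinal.mk_list_le_max _).trans ?_
    exact max_le (le_max_right _ _) hcS
  have h1 : @iweight X t ≤ @weight X t' :=
    ciInf_le' (fun t' : {t' : TopologicalSpace X // t ≤ t' ∧ @T35Space X t'} => @weight X t'.1)
      ⟨t', hle, h35⟩
  have h2 : @weight X t' ≤ _ :=
    ciInf_le' (fun B : {B : Set (Set X) // @TopologicalSpace.IsTopologicalBasis X t' B} => #↥B.1)
      ⟨_, hb⟩
  exact h1.trans (h2.trans hcB)

theorem iw_witness (X : Type u) [t : TopologicalSpace X] [h35 : T35Space X] :
    ∃ t' : TopologicalSpace X, t ≤ t' ∧ @T35Space X t' ∧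
      ∃ B : Set (Set X), @TopologicalSpace.IsTopologicalBasis X t' B ∧ @iweight X t = #↥B := by
  have : Nonempty {t' : TopologicalSpace X // t ≤ t' ∧ @T35Space X t'} := ⟨⟨t, le_rfl, h35⟩⟩
  obtain ⟨⟨t', h1, h2⟩, h3⟩ := ciInf_mem
    (fun t' : {t' : TopologicalSpace X // t ≤ t' ∧ @T35Space X t'} => @weight X t'.1)
  have : Nonempty {B : Set (Set X) // @TopologicalSpace.IsTopologicalBasis X t' B} :=
    ⟨⟨_, @TopologicalSpace.isTopologicalBasis_opens X t'⟩⟩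
  obtain ⟨⟨B, hB⟩, h4⟩ := ciInf_mem
    (fun B : {B : Set (Set X) // @TopologicalSpace.IsTopologicalBasis X t' B} => #↥B.1)
  refine ⟨t', h1, h2, B, hB, ?_⟩
  exact h3.symm.trans h4.symm

theorem aleph0_le_iw (X : Type u) [t : TopologicalSpace X] [h35 : T35Space X] [Infinite X] :
    ℵ₀ ≤ iweight X := by
  obtain ⟨t', -, h2, B, hB, h⟩ := iw_witness X
  rw [h]
  by_contra hlt
  rw [not_le, Cardinal.lt_aleph0_iff_finite] at hlt
  have inj : Function.Injective (fun x : X => {U : ↥B | x ∈ U.1}) := by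
    intro x y hxy
    by_contra hne
    have : @IsOpen X t' {y}ᶜ := isOpen_compl_singleton
    obtain ⟨V, hV, hxV, hsub⟩ := hB.exists_subset_of_mem_open
      (show x ∈ ({y}ᶜ : Set X) from hne) this
    have h5 : (⟨V, hV⟩ : ↥B) ∈ {U : ↥B | x ∈ U.1} := hxV
    have hxy' : {U : ↥B | x ∈ U.1} = {U : ↥B | y ∈ U.1} := hxy
    rw [hxy'] at h5
    exact hsub h5 rfl
  have := Finite.of_injective _ inj
  exact not_finite X

theorem exists_sep (X : Type u) [t : TopologicalSpace X] [h35 : T35Space X] [Infinite X] :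
    ∃ (ι : Type u) (g : ι → X → ℝ), #ι ≤ iweight X ∧ (∀ i, @Continuous X ℝ t _ (g i)) ∧
      (∀ i x, 0 ≤ g i x ∧ g i x ≤ 1) ∧ ∀ x y, x ≠ y → ∃ i, g i x ≠ g i y := by
  have hal := aleph0_le_iw X
  obtain ⟨t', hle, h2, B, hB, h⟩ := iw_witness X
  let P : ↥B × ↥B → (X → ℝ) → Prop := fun p f => @Continuous X ℝ t _ f ∧ (∀ x, 0 ≤ f x ∧ f x ≤ 1) ∧
    (∀ x ∈ p.1.1, f x < 1/2) ∧ ∀ x, x ∉ p.2.1 → f x = 1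
  refine ⟨{p : ↥B × ↥B // ∃ f, P p f}, fun p => p.2.choose, ?_, fun p => p.2.choose_spec.1,
    fun p => p.2.choose_spec.2.1, ?_⟩
  · refine (Cardinal.mk_subtype_le _).trans ?_
    rw [h] at hal ⊢
    rw [Cardinal.mk_prod, Cardinal.lift_id, Cardinal.mul_eq_self hal]
  · intro x y hne
    have : @IsOpen X t' {y}ᶜ := isOpen_compl_singleton
    obtain ⟨V, hV, hxV, hsub⟩ := hB.exists_subset_of_mem_open
      (show x ∈ ({y}ᶜ : Set X) from hne) this
    obtain ⟨f, hf, hf0, hf1⟩ := @CompletelyRegularSpace.completely_regular_isOpen X t' _ x V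
      (hB.isOpen hV) hxV
    have ho : @IsOpen X t' {z | (f z : ℝ) < 1/2} := by
      have : @Continuous X ℝ t' _ (fun z => (f z : ℝ)) := continuous_subtype_val.comp hf
      exact isOpen_Iio.preimage this
    obtain ⟨U, hU, hxU, hsubU⟩ := hB.exists_subset_of_mem_open
      (show x ∈ {z | (f z : ℝ) < 1/2} by simp [hf0]) ho
    have hP : ∃ f, P (⟨U, hU⟩, ⟨V, hV⟩) f := by
      refine ⟨fun z => (f z : ℝ), ?_, fun z => ⟨(f z).2.1, (f z).2.2⟩, fun z hz => hsubU hz, ?_⟩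
      · have : @Continuous X ℝ t' _ (fun z => (f z : ℝ)) := continuous_subtype_val.comp hf
        exact @continuous_le_dom X ℝ _ t' t _ hle this
      · intro z hz
        have := hf1 hz
        simp [this]
    refine ⟨⟨_, hP⟩, ?_⟩
    have a := hP.choose_spec.2.2.1 x hxU
    have b := hP.choose_spec.2.2.2 y (fun hy => hsub hy rfl)
    intro hh
    have hh' : hP.choose x = hP.choose y := hh
    rw [hh', b] at a
    norm_num at a

/-- Limit case: if `iw(X)` is an uncountable strong limit then `X²` has a discrete subspace
of that size. -/
theorem limit_case {X : Type u} [TopologicalSpace X] [T35Space X]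
    (hk : ℵ₀ < iweight X) (hlim : ∀ c < iweight X, (2 : Cardinal.{u}) ^ c < iweight X) :
    ∃ (ι : Type u) (d : ι → (Fin 2 → X)) (O : ι → Set (Fin 2 → X)), #ι = iweight X ∧
      (∀ i, IsOpen (O i)) ∧ (∀ i, d i ∈ O i) ∧ ∀ i j, d j ∈ O i → j = i := by
  classical
  let ι := (iweight X).ord.ToType
  let T := (Fin 2 → X) × {f : X → ℝ // Continuous f}
  let good : ∀ i : ι, (∀ j, j < i → T) → T → Prop := fun i prev t =>
    t.2.1 (t.1 0) ≠ t.2.1 (t.1 1) ∧ ∀ j (hj : j < i),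
      ((prev j hj).2.1 (t.1 0) = (prev j hj).2.1 (t.1 1)) ∧
      t.2.1 ((prev j hj).1 0) = t.2.1 ((prev j hj).1 1)
  have step : ∀ (i : ι) (prev : ∀ j, j < i → T), ∃ t, good i prev t := by
    intro i prev
    let J := ↥(Set.Iio i)
    have hJ : #J < iweight X := by
      simpa [ι] using Cardinal.mk_Iio_lt i (by simp [ι])
    let A : J × ULift.{u} (Fin 2) → X := fun a => (prev a.1.1 a.1.2).1 a.2.down
    let K := J × ULift.{u} (Fin 2) → ULift.{u} ℝ
    let R : K → X → ℝ := fun φ =>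
      if h : ∃ f : X → ℝ, Continuous f ∧ ∀ a, f (A a) = (φ a).down then h.choose else fun _ => 0
    let g : J ⊕ K → X → ℝ := Sum.elim (fun j => (prev j.1 j.2).2.1) R
    have hg : ∀ k, Continuous (g k) := by
      rintro (j | φ)
      · exact (prev j.1 j.2).2.2
      · show Continuous (R φ)
        dsimp only [R]
        split_ifs with h
        · exact h.choose_spec.1
        · exact continuous_const
    have hcard : max #(J ⊕ K) ℵ₀ < iweight X := by
      refine max_lt ?_ hk
      rw [Cardinal.mk_sum, Cardinal.lift_id, Cardinal.lift_id]
      refine Cardinal.add_lt_of_lt hk.le hJ ?_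
      have : #K = 2 ^ (ℵ₀ * (#J * 2)) := by
        rw [Cardinal.power_mul, Cardinal.two_power_aleph0]
        simp [K, Cardinal.mk_real]
      rw [this]
      apply hlim
      refine Cardinal.mul_lt_of_lt hk.le hk (Cardinal.mul_lt_of_lt hk.le hJ ?_)
      exact (Cardinal.natCast_lt_aleph0 (n := 2)).trans hk
    have hns : ∃ x y, x ≠ y ∧ ∀ k, g k x = g k y := by
      by_contra hcon
      push Not at hcon
      exact absurd (iw_le g hg hcon) (not_le.2 hcard)
    obtain ⟨x, y, hne, hxy⟩ := hns
    obtain ⟨f, hf, hfxy⟩ := separatesPoints_continuous_of_t35Space hne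
    have hex : ∃ f' : X → ℝ, Continuous f' ∧ ∀ a, f' (A a) = ((fun a => ⟨f (A a)⟩ : K) a).down :=
      ⟨f, hf, fun a => rfl⟩
    have hr : ∀ a, R (fun a => ⟨f (A a)⟩) (A a) = f (A a) := by
      intro a
      dsimp only [R]
      rw [dif_pos hex]
      exact hex.choose_spec.2 a
    have hrxy : R (fun a => ⟨f (A a)⟩) x = R (fun a => ⟨f (A a)⟩) y := hxy (Sum.inr _)
    have hRc : Continuous (R (fun a => ⟨f (A a)⟩)) := hg (Sum.inr _)
    refine ⟨(![x, y], ⟨fun z => f z - R (fun a => ⟨f (A a)⟩) z, hf.sub hRc⟩), ?_, ?_⟩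
    · show f x - R (fun a => ⟨f (A a)⟩) x ≠ f y - R (fun a => ⟨f (A a)⟩) y
      rw [hrxy]
      intro h
      exact hfxy (by linarith)
    · intro j hj
      refine ⟨hxy (Sum.inl ⟨j, hj⟩), ?_⟩
      have h0 := hr (⟨j, hj⟩, ⟨0⟩)
      have h1 := hr (⟨j, hj⟩, ⟨1⟩)
      show f (A (⟨j, hj⟩, ⟨0⟩)) - R _ (A (⟨j, hj⟩, ⟨0⟩)) =
        f (A (⟨j, hj⟩, ⟨1⟩)) - R _ (A (⟨j, hj⟩, ⟨1⟩))
      rw [h0, h1]; ring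
  have wf : WellFounded (fun a b : ι => a < b) := wellFounded_lt
  let s : ι → T := wf.fix (fun i prev => (step i prev).choose)
  have hs : ∀ i, good i (fun j _ => s j) (s i) := by
    intro i
    have : s i = (step i (fun j _ => s j)).choose := wf.fix_eq _ i
    rw [this]
    exact (step i (fun j _ => s j)).choose_spec
  refine ⟨ι, fun i => (s i).1, fun i => {z | (s i).2.1 (z 0) ≠ (s i).2.1 (z 1)}, ?_, ?_, ?_, ?_⟩
  · exact Cardinal.mk_ord_toType _
  · intro i
    exact isOpen_ne_fun ((s i).2.2.comp (continuous_apply 0)) ((s i).2.2.comp (continuous_apply 1))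
  · intro i
    exact (hs i).1
  · intro i j hij
    rcases lt_trichotomy i j with h | h | h
    · exact absurd ((hs j).2 i h).1 hij
    · exact h.symm
    · exact absurd ((hs i).2 j h).2 hij

/-- The set of all values of bumps: a pair of functions encoding a tuple. -/
theorem bump {X : Type u} [TopologicalSpace X] [T35Space X] {n : ℕ} (d : Fin n → X)
    (W : Fin n → Set X) (hW : ∀ i, IsOpen (W i)) (hd : ∀ i, d i ∈ W i) (r : Fin n → Fin n)
    (hr : ∀ i, d (r i) = d i) (hr' : ∀ i j, d i = d j → r i = r j) :
    ∃ f f' : X → ℝ, Continuous f ∧ Continuous f' ∧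
      (∀ i, f (d i) = 1 ∧ f' (d i) = ((r i : ℕ) : ℝ)) ∧
      ∀ x, 0 ≤ f x ∧ ((f x = 0 ∧ f' x = 0) ∨
        ∃ j : Fin n, f' x = ((j : ℕ) : ℝ) * f x ∧ ∀ i, r i = j → x ∈ W i) := by
  classical
  obtain ⟨U, hU, hUd⟩ := (Set.finite_range d).t2_separation
  let V : Fin n → Set X := fun j => U (d j) ∩ ⋂ i ∈ {i | r i = j}, W i
  have hV : ∀ j, IsOpen (V j) := fun j =>
    (hU _).2.inter ((Set.toFinite _).isOpen_biInter fun i _ => hW i)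
  have hdV : ∀ j, d j ∈ V j := by
    intro j
    refine ⟨(hU _).1, ?_⟩
    simp only [mem_iInter]
    intro i hi
    have : r i = j := hi
    rw [← this, hr]
    exact hd i
  have hh : ∀ j, ∃ h : X → ℝ, Continuous h ∧ (∀ x, 0 ≤ h x) ∧ h (d j) = 1 ∧
      ∀ x, x ∉ V j → h x = 0 := by
    intro j
    obtain ⟨f, hf, hf0, hf1⟩ := CompletelyRegularSpace.completely_regular_isOpen (d j) (V j)
      (hV j) (hdV j)
    refine ⟨fun x => 1 - (f x : ℝ), continuous_const.sub (continuous_subtype_val.comp hf),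
      fun x => by linarith [(f x).2.2], by simp [hf0], fun x hx => ?_⟩
    have := hf1 hx
    simp [this]
  choose h hc hnn h1 h0 using hh
  let S : Finset (Fin n) := Finset.univ.filter fun j => r j = j
  have hrr : ∀ i, r (r i) = r i := fun i => hr' _ _ (hr i)
  have key : ∀ x, (∀ j ∈ S, h j x = 0) ∨ ∃ j ∈ S, x ∈ V j ∧ ∀ k ∈ S, k ≠ j → h k x = 0 := by
    intro x
    by_cases hx : ∀ j ∈ S, h j x = 0
    · exact Or.inl hx
    · push Not at hx
      obtain ⟨j, hj, hjx⟩ := hx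
      have hxj : x ∈ V j := by
        by_contra hcon
        exact hjx (h0 j x hcon)
      refine Or.inr ⟨j, hj, hxj, fun k hk hkj => ?_⟩
      apply h0
      intro hxk
      have hne : d k ≠ d j := by
        intro he
        have := hr' _ _ he
        rw [(Finset.mem_filter.1 hk).2, (Finset.mem_filter.1 hj).2] at this
        exact hkj this
      exact Set.disjoint_left.1 (hUd ⟨k, rfl⟩ ⟨j, rfl⟩ hne) hxk.1 hxj.1
  have ev : ∀ x, ∀ j ∈ S, (∀ k ∈ S, k ≠ j → h k x = 0) →
      (∑ k ∈ S, h k x = h j x ∧ ∑ k ∈ S, ((k : ℕ) : ℝ) * h k x = ((j : ℕ) : ℝ) * h j x) := by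
    intro x j hj hk
    constructor
    · exact Finset.sum_eq_single_of_mem j hj hk
    · exact Finset.sum_eq_single_of_mem j hj fun k hkS hkj => by rw [hk k hkS hkj, mul_zero]
  refine ⟨fun x => ∑ k ∈ S, h k x, fun x => ∑ k ∈ S, ((k : ℕ) : ℝ) * h k x,
    continuous_finsetSum _ fun k _ => hc k,
    continuous_finsetSum _ fun k _ => continuous_const.mul (hc k), ?_, ?_⟩
  · intro i
    have hm : r i ∈ S := by simp [S, hrr]
    have hone : h (r i) (d i) = 1 := by rw [← hr i]; exact h1 (r i)
    have : ∀ k ∈ S, k ≠ r i → h k (d i) = 0 := by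
      intro k hk hkj
      apply h0
      intro hxk
      have hne : d k ≠ d i := by
        intro he
        have := hr' _ _ he
        rw [(Finset.mem_filter.1 hk).2] at this
        exact hkj this
      exact Set.disjoint_left.1 (hUd ⟨k, rfl⟩ ⟨i, rfl⟩ hne) hxk.1 (hU _).1
    obtain ⟨e1, e2⟩ := ev (d i) (r i) hm this
    dsimp only
    rw [e1, e2, hone]
    simp
  · intro x
    refine ⟨Finset.sum_nonneg fun k _ => hnn k x, ?_⟩
    rcases key x with hz | ⟨j, hj, hxj, hk⟩
    · left
      exact ⟨Finset.sum_eq_zero hz, Finset.sum_eq_zero fun k hk => by rw [hz k hk, mul_zero]⟩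
    · right
      obtain ⟨e1, e2⟩ := ev x j hj hk
      refine ⟨j, by dsimp only; rw [e1, e2], fun i hi => ?_⟩
      have := hxj.2
      simp only [mem_iInter] at this
      exact this i hi

theorem cone {n i j : ℕ} (hi : i < n) {t e : ℝ} (ht : 0 ≤ t) (he : 0 ≤ e)
    (he' : e * (8 * (n + 1)) ≤ 1) (ha : 1 / 2 < t + e)
    (hb : |(j : ℝ) * t - i * (t + e)| < (t + e) / 2) : j = i := by
  rw [abs_lt] at hb
  have hin : (i : ℝ) + 1 ≤ n := by exact_mod_cast hi
  have hi0 : (0 : ℝ) ≤ i := by positivity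
  have hie : (i : ℝ) * e ≤ 1 / 8 - e := by nlinarith
  rcases lt_trichotomy j i with h | h | h
  · have h' : (j : ℝ) + 1 ≤ i := by exact_mod_cast h
    nlinarith [mul_le_mul_of_nonneg_right h' ht]
  · exact h
  · have h' : (i : ℝ) + 1 ≤ j := by exact_mod_cast h
    nlinarith [mul_le_mul_of_nonneg_right h' ht]

theorem construct {X : Type u} [TopologicalSpace X] [T35Space X] [Infinite X] {n : ℕ}
    (hn : 1 ≤ n) (D : Set (Fin n → X)) (hD : DiscreteTopology ↥D) (hc : iweight X ≤ #↥D) :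
    ∃ F : Set (Cp X × Cp X), DiscreteTopology ↥F ∧ PointSep2 F := by
  classical
  have hal := aleph0_le_iw X
  obtain ⟨ι, g, hι, hgc, hgb, hgs⟩ := exists_sep X
  -- pattern of equal coordinates
  have : Nonempty (Fin n) := ⟨⟨0, hn⟩⟩
  let pat : (Fin n → X) → Fin n → Fin n := fun d i => Classical.epsilon fun j => d j = d i
  have hpat : ∀ (d : Fin n → X) i, d (pat d i) = d i := fun d i =>
    Classical.epsilon_spec (p := fun j => d j = d i) ⟨i, rfl⟩
  have hpat' : ∀ (d : Fin n → X) i j, d i = d j → pat d i = pat d j := by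
    intro d i j h
    simp only [pat, h]
  obtain ⟨r, hr⟩ := Cardinal.infinite_pigeonhole_card
    (fun d : ↥D => (ULift.up (pat d.1) : ULift.{u} (Fin n → Fin n))) (iweight X) hc hal (by
      refine lt_of_lt_of_le (Cardinal.lt_aleph0_of_finite _) ?_
      rw [Ordinal.aleph0_le_cof_iff, Ordinal.one_lt_cof_iff]
      exact Cardinal.isSuccLimit_ord hal)
  let E := ↥((fun d : ↥D => (ULift.up (pat d.1) : ULift.{u} (Fin n → Fin n))) ⁻¹' {r})
  have hE : ∀ d : E, pat d.1.1 = r.down := fun d => congrArg ULift.down d.2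
  have hιE : #ι ≤ #E := hι.trans hr
  obtain ⟨emb⟩ := Cardinal.le_def _ _ |>.1 hιE
  have hne : Nonempty ι := by
    obtain ⟨x, y, hxy⟩ := exists_pair_ne X
    exact ⟨(hgs x y hxy).choose⟩
  let G : E → X → ℝ := fun d => g (Function.invFun emb d)
  have hGs : ∀ x y, x ≠ y → ∃ d, G d x ≠ G d y := by
    intro x y hxy
    obtain ⟨i, hi⟩ := hgs x y hxy
    refine ⟨emb i, ?_⟩
    simp only [G]
    rw [Function.leftInverse_invFun emb.injective i]
    exact hi
  have hbox : ∀ d : E, ∃ W : Fin n → Set X, (∀ i, IsOpen (W i)) ∧ (∀ i, d.1.1 i ∈ W i) ∧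
      ∀ d' : E, (∀ i, d'.1.1 i ∈ W i) → d' = d := by
    intro d
    obtain ⟨U, hU, hdU, huniq⟩ := discrete_nhd D hD d.1.1 d.1.2
    obtain ⟨W, hW, hsub⟩ := isOpen_pi_iff'.1 hU _ hdU
    refine ⟨W, fun i => (hW i).1, fun i => (hW i).2, fun d' hd' => ?_⟩
    exact Subtype.ext (Subtype.ext (huniq _ d'.1.2 (hsub fun i _ => hd' i)))
  choose W hWo hWd hWu using hbox
  have hb : ∀ d : E, _ := fun d => bump d.1.1 (W d) (hWo d) (hWd d) r.down
    (fun i => by rw [← hE d]; exact hpat _ i) (fun i j h => by rw [← hE d]; exact hpat' _ i j h)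
  choose f f' hfc hfc' hfd hfx using hb
  let ε : ℝ := 1 / (8 * (n + 1))
  have hε : 0 < ε := by positivity
  have hε1 : ε * (8 * (n + 1)) = 1 := by
    simp only [ε]; field_simp
  let e : E → X → ℝ := fun d x => ε * G d x
  have he0 : ∀ d x, 0 ≤ e d x := fun d x => mul_nonneg hε.le (hgb _ x).1
  have he1 : ∀ d x, e d x * (8 * (n + 1)) ≤ 1 := by
    intro d x
    have h1 : e d x ≤ ε := mul_le_of_le_one_right hε.le (hgb _ x).2
    exact (mul_le_mul_of_nonneg_right h1 (by positivity)).trans hε1.le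
  have hec : ∀ d, Continuous (e d) := fun d => continuous_const.mul (hgc _)
  let Φ : E × Bool → Cp X × Cp X := fun p =>
    if p.2 then (⟨fun x => 3 * f p.1 x + e p.1 x, (continuous_const.mul (hfc _)).add (hec _)⟩,
      ⟨fun x => 3 * f' p.1 x, continuous_const.mul (hfc' _)⟩)
    else (⟨f p.1, hfc _⟩, ⟨f' p.1, hfc' _⟩)
  let Q : Fin n → Set (ℝ × ℝ) := fun j => {z | 1 / 2 < z.1 ∧ |z.2 - ((j : ℕ) : ℝ) * z.1| < z.1 / 2}
  have hQ : ∀ j, IsOpen (Q j) := by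
    intro j
    have q1 : IsOpen {z : ℝ × ℝ | 1 / 2 < z.1} := isOpen_lt (by fun_prop) (by fun_prop)
    have q2 : IsOpen {z : ℝ × ℝ | |z.2 - ((j : ℕ) : ℝ) * z.1| < z.1 / 2} :=
      isOpen_lt (by fun_prop) (by fun_prop)
    exact q1.inter q2
  have hQm : ∀ (p : E × Bool) x j, ((Φ p).1.1 x, (Φ p).2.1 x) ∈ Q j →
      ∀ i, r.down i = j → x ∈ W p.1 i := by
    rintro ⟨d, b⟩ x j hq i hi
    obtain ⟨h0, h⟩ := hfx d x
    cases b with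
    | false =>
      obtain ⟨q1, q2⟩ : 1 / 2 < f d x ∧ |f' d x - ((j : ℕ) : ℝ) * f d x| < f d x / 2 := hq
      rcases h with ⟨hz, -⟩ | ⟨k, hk, hkW⟩
      · rw [hz] at q1; norm_num at q1
      · rw [hk] at q2
        have := cone (n := n) (i := j) (j := k) j.2 h0 le_rfl (by simp)
          (by simpa using q1) (by simpa using q2)
        exact hkW i (hi.trans (Fin.ext this).symm)
    | true =>
      obtain ⟨q1, q2⟩ : 1 / 2 < 3 * f d x + e d x ∧
        |3 * f' d x - ((j : ℕ) : ℝ) * (3 * f d x + e d x)| < (3 * f d x + e d x) / 2 := hq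
      have := he0 d x
      have h8 := he1 d x
      rcases h with ⟨hz, -⟩ | ⟨k, hk, hkW⟩
      · rw [hz] at q1
        have hnn : (0 : ℝ) ≤ n := by positivity
        nlinarith [mul_nonneg (he0 d x) hnn]
      · rw [hk] at q2
        have := cone (n := n) (i := j) (j := k) j.2 (t := 3 * f d x) (by linarith) (he0 d x) h8
          q1 (by convert q2 using 2; ring)
        exact hkW i (hi.trans (Fin.ext this).symm)
  let i0 : Fin n := ⟨0, hn⟩
  let B : Bool → Set ℝ := fun b => if b then Ioi 2 else Iio 2
  have hB : ∀ b, IsOpen (B b) := by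
    rintro (_ | _)
    · exact isOpen_Iio
    · exact isOpen_Ioi
  have hev1 : ∀ x, Continuous fun p : Cp X × Cp X => p.1.1 x := fun x =>
    (continuous_apply x).comp (continuous_subtype_val.comp continuous_fst)
  have hev2 : ∀ x, Continuous fun p : Cp X × Cp X => p.2.1 x := fun x =>
    (continuous_apply x).comp (continuous_subtype_val.comp continuous_snd)
  have hΦB : ∀ (d : E) b, (Φ (d, b)).1.1 (d.1.1 i0) ∈ B b := by
    rintro d (_ | _)
    · show f d (d.1.1 i0) < 2
      rw [(hfd d i0).1]; norm_num
    · show 2 < 3 * f d (d.1.1 i0) + e d (d.1.1 i0)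
      rw [(hfd d i0).1]
      linarith [he0 d (d.1.1 i0)]
  have hBd : ∀ b b' z, z ∈ B b → z ∈ B b' → b' = b := by
    rintro (_ | _) (_ | _) z h h'
    · rfl
    · exact absurd (show z < 2 from h) (not_lt.2 (le_of_lt (show 2 < z from h')))
    · exact absurd (show z < 2 from h') (not_lt.2 (le_of_lt (show 2 < z from h)))
    · rfl
  let O : E × Bool → Set (Cp X × Cp X) := fun p =>
    (⋂ i, {q | (q.1.1 (p.1.1.1 i), q.2.1 (p.1.1.1 i)) ∈ Q (r.down i)}) ∩
      {q | q.1.1 (p.1.1.1 i0) ∈ B p.2}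
  refine ⟨Set.range Φ, range_discrete Φ O ?_ ?_ ?_, ?_⟩
  · intro p
    exact (isOpen_iInter_of_finite fun i =>
      (hQ _).preimage ((hev1 _).prodMk (hev2 _))).inter ((hB _).preimage (hev1 _))
  · rintro ⟨d, b⟩
    refine ⟨?_, hΦB d b⟩
    rw [mem_iInter]
    intro i
    obtain ⟨h1, h2⟩ := hfd d i
    cases b with
    | false =>
      show 1 / 2 < f d _ ∧ |f' d _ - _ * f d _| < f d _ / 2
      rw [h1, h2]; norm_num
    | true =>
      show 1 / 2 < 3 * f d _ + e d _ ∧ |3 * f' d _ - _ * (3 * f d _ + e d _)| <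
        (3 * f d _ + e d _) / 2
      rw [h1, h2]
      have e0 := he0 d (d.1.1 i)
      have e1 := he1 d (d.1.1 i)
      have hin : (((r.down i : Fin n) : ℕ) : ℝ) + 1 ≤ n := by exact_mod_cast (r.down i).2
      have hi0 : (0 : ℝ) ≤ ((r.down i : Fin n) : ℕ) := by positivity
      refine ⟨by linarith, ?_⟩
      rw [abs_lt]
      constructor <;> nlinarith [mul_nonneg hi0 e0]
  · rintro ⟨d, b⟩ ⟨d', b'⟩ ⟨h1, h2⟩
    rw [mem_iInter] at h1
    have hdd : d = d' := hWu d' d fun i => hQm (d', b') _ _ (h1 i) i rfl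
    subst hdd
    rw [hBd _ _ _ h2 (hΦB d b')]
  · intro x y hxy
    obtain ⟨d, hd⟩ := hGs x y hxy
    by_contra hcon
    push Not at hcon
    have h1 := (hcon (Φ (d, false)) ⟨_, rfl⟩).1
    have h2 := (hcon (Φ (d, true)) ⟨_, rfl⟩).1
    have h1' : f d x = f d y := h1
    have h2' : 3 * f d x + ε * G d x = 3 * f d y + ε * G d y := h2
    apply hd
    rw [h1'] at h2'
    exact mul_left_cancel₀ hε.ne' (by linarith)

theorem succ_case {X : Type u} [TopologicalSpace X] {ν : Cardinal.{u}}
    (hν : ℵ₀ ≤ ν) (hs : ∀ n : ℕ, 1 ≤ n → spread (Fin n → X) ≤ ν)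
    (F : Set (Cp X × Cp X)) (hF : DiscreteTopology ↥F) : #↥F ≤ ν := by
  classical
  by_contra hlt
  rw [not_le] at hlt
  let C := Σ n : ℕ, (Fin n → ↥(TopologicalSpace.countableBasis (ℝ × ℝ)))
  have : Countable ↥(TopologicalSpace.countableBasis (ℝ × ℝ)) :=
    (TopologicalSpace.countable_countableBasis (ℝ × ℝ)).to_subtype
  have hC : Countable C := inferInstance
  have hs' : ∀ n : ℕ, spread (Fin n → X) ≤ ν := by
    intro n
    rcases Nat.eq_zero_or_pos n with rfl | h
    · refine ciSup_le' fun D => ?_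
      exact (Cardinal.mk_le_aleph0 (α := ↥D.1)).trans hν
    · exact hs n h
  let E : Cp X × Cp X → X → ℝ × ℝ := fun p x => (p.1.1 x, p.2.1 x)
  have hE : Topology.IsInducing E := by
    have h0 : Topology.IsInducing (fun f : Cp X => f.1) := ⟨rfl⟩
    have h1 : Topology.IsInducing (fun p : Cp X × Cp X => ((p.1.1, p.2.1) : (X → ℝ) × (X → ℝ))) :=
      h0.prodMap h0
    have h2 : Topology.IsInducing
        (fun (q : (X → ℝ) × (X → ℝ)) (x : X) => ((q.1 x, q.2 x) : ℝ × ℝ)) := by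
      refine Topology.IsInducing.of_comp (g := fun w : X → ℝ × ℝ =>
        (((fun x => (w x).1), (fun x => (w x).2)) : (X → ℝ) × (X → ℝ))) (by fun_prop)
        (by fun_prop) Topology.IsInducing.id
    exact h2.comp h1
  have hcode : ∀ p : ↥F, ∃ (c : C) (x : Fin c.1 → X), (∀ i, E p.1 (x i) ∈ (c.2 i).1) ∧
      ∀ q : ↥F, (∀ i, E q.1 (x i) ∈ (c.2 i).1) → q = p := by
    intro p
    obtain ⟨U, hU, hpU, huniq⟩ := discrete_nhd F hF p.1 p.2
    obtain ⟨V, hV, rfl⟩ := hE.isOpen_iff.1 hU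
    have hb := isTopologicalBasis_pi
      (fun _ : X => TopologicalSpace.isBasis_countableBasis (ℝ × ℝ))
    obtain ⟨_, ⟨w, I, hw, rfl⟩, hpw, hsub⟩ := hb.exists_subset_of_mem_open hpU hV
    let eq := I.equivFin
    refine ⟨⟨I.card, fun i => ⟨w (eq.symm i).1, hw _ (eq.symm i).2⟩⟩, fun i => (eq.symm i).1,
      fun i => hpw _ (eq.symm i).2, fun q hq => ?_⟩
    apply Subtype.ext
    apply huniq _ q.2
    apply hsub
    intro x hx
    have := hq (eq ⟨x, hx⟩)
    simpa using this
  choose c x hx hxu using hcode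
  obtain ⟨a, ha⟩ := Cardinal.infinite_pigeonhole_card
    (fun p : ↥F => (ULift.up (c p) : ULift.{u} C)) (Order.succ ν) (Order.succ_le_of_lt hlt)
    (hν.trans (Order.le_succ ν)) (by
      rw [(Cardinal.isRegular_succ hν).cof_ord]
      exact lt_of_le_of_lt (Cardinal.mk_le_aleph0.trans hν) (Order.lt_succ ν))
  obtain ⟨a⟩ := a
  let P := ↥((fun p : ↥F => (ULift.up (c p) : ULift.{u} C)) ⁻¹' {ULift.up a})
  have hP : ∀ p : P, c p.1 = a := fun p => congrArg ULift.down p.2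
  have hP' : ∀ p : P, ∃ y : Fin a.1 → X, (∀ i, E p.1.1 (y i) ∈ (a.2 i).1) ∧
      ∀ q : ↥F, (∀ i, E q.1 (y i) ∈ (a.2 i).1) → q = p.1 := by
    have key : ∀ (p0 : ↥F) (a' : C), c p0 = a' → ∃ y : Fin a'.1 → X,
        (∀ i, E p0.1 (y i) ∈ (a'.2 i).1) ∧
        ∀ q : ↥F, (∀ i, E q.1 (y i) ∈ (a'.2 i).1) → q = p0 := by
      rintro p0 _ rfl
      exact ⟨x p0, hx p0, hxu p0⟩
    intro p
    exact key p.1 a (hP p)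
  choose y hy hyu using hP'
  have hle : #P ≤ spread (Fin a.1 → X) := by
    refine le_spread y (fun p => ⋂ i, {z | E p.1.1 (z i) ∈ (a.2 i).1}) ?_ ?_ ?_
    · intro p
      refine isOpen_iInter_of_finite fun i => ?_
      refine (TopologicalSpace.isOpen_of_mem_countableBasis (a.2 i).2).preimage ?_
      exact (p.1.1.1.2.comp (continuous_apply i)).prodMk (p.1.1.2.2.comp (continuous_apply i))
    · intro p
      exact mem_iInter.2 fun i => hy p i
    · intro p q h
      have := hyu q p.1 fun i => mem_iInter.1 h i
      exact (Subtype.ext this).symm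
  exact absurd (ha.trans (hle.trans (hs' _))) (not_le.2 (Order.lt_succ ν))

theorem aleph0_discrete (X : Type u) [TopologicalSpace X] [T35Space X] [Infinite X] :
    ∃ D : Set (Fin 1 → X), DiscreteTopology ↥D ∧ ℵ₀ ≤ #↥D := by
  obtain ⟨D, h1, h2⟩ := exists_infinite_discreteTopology (Fin 1 → X)
  exact ⟨D, h2, Cardinal.aleph0_le_mk_iff.2 h1.to_subtype⟩

/-- Under GCH, either the i-weight is a successor or some finite power has a discrete subspace
of size `iw(X)`. -/
theorem dichotomy {X : Type u} [TopologicalSpace X] [T35Space X] [Infinite X]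
    (gch : ∀ κ : Cardinal.{u}, ℵ₀ ≤ κ → 2 ^ κ = Order.succ κ) :
    (∃ ν, ℵ₀ ≤ ν ∧ iweight X = Order.succ ν) ∨
    ∃ n : ℕ, 1 ≤ n ∧ ∃ D : Set (Fin n → X), DiscreteTopology ↥D ∧ iweight X ≤ #↥D := by
  have hal := aleph0_le_iw X
  rcases hal.eq_or_lt with h | hk
  · right
    obtain ⟨D, h1, h2⟩ := aleph0_discrete X
    exact ⟨1, le_rfl, D, h1, h ▸ h2⟩
  · by_cases hsucc : ∃ ν, ℵ₀ ≤ ν ∧ iweight X = Order.succ ν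
    · exact Or.inl hsucc
    · right
      push Not at hsucc
      obtain ⟨ι, d, O, hc, h1, h2, h3⟩ := limit_case hk (X := X) (by
        intro c hcl
        have hm : max c ℵ₀ < iweight X := max_lt hcl hk
        refine lt_of_le_of_lt (Cardinal.power_le_power_left two_ne_zero (le_max_left c ℵ₀)) ?_
        rw [gch _ (le_max_right _ _)]
        exact lt_of_le_of_ne (Order.succ_le_of_lt hm) (hsucc _ (le_max_right _ _)).symm)
      refine ⟨2, by norm_num, Set.range d, range_discrete d O h1 h2 h3, ?_⟩
      have inj : Function.Injective d := fun i j h => (h3 j i (h ▸ h2 j))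
      rw [Cardinal.mk_range_eq d inj, hc]

/-- (GCH) `C_p^2(X)` has a point-separating discrete subspace iff `s(X^n) ≥ iw(X)` for
some `n ≥ 1`. -/
theorem stmt7 {X : Type u} [TopologicalSpace X] [T35Space X] [Infinite X]
    (gch : ∀ κ : Cardinal.{u}, ℵ₀ ≤ κ → 2 ^ κ = Order.succ κ) :
    (∃ F : Set (Cp X × Cp X), DiscreteTopology ↥F ∧ PointSep2 F) ↔
      ∃ n : ℕ, 1 ≤ n ∧ iweight X ≤ spread (Fin n → X) := by
  constructor
  · rintro ⟨F, hF, hsep⟩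
    rcases dichotomy (X := X) gch with ⟨ν, hν, hiw⟩ | ⟨n, hn, D, hD, hc⟩
    · by_contra hcon
      push Not at hcon
      have hle : #↥F ≤ ν := succ_case hν (fun n hn => by
        have := hcon n hn
        rw [hiw] at this
        exact Order.lt_succ_iff.1 this) F hF
      have h2 : iweight X ≤ max #(↥F ⊕ ↥F) ℵ₀ := iw_le
        (Sum.elim (fun p : ↥F => p.1.1.1) (fun p : ↥F => p.1.2.1))
        (by
          rintro (p | p)
          · exact p.1.1.2
          · exact p.1.2.2)
        (by
          intro x y hxy
          obtain ⟨p, hp, h | h⟩ := hsep x y hxy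
          · exact ⟨Sum.inl ⟨p, hp⟩, h⟩
          · exact ⟨Sum.inr ⟨p, hp⟩, h⟩)
      have h3 : max #(↥F ⊕ ↥F) ℵ₀ ≤ ν := by
        refine max_le ?_ hν
        rw [Cardinal.mk_sum, Cardinal.lift_id]
        exact Cardinal.add_le_of_le hν hle hle
      have h4 := h2.trans h3
      rw [hiw] at h4
      exact absurd h4 (not_le.2 (Order.lt_succ ν))
    · exact ⟨n, hn, hc.trans (le_spread_set D hD)⟩
  · rintro ⟨n, hn, hle⟩
    rcases dichotomy (X := X) gch with ⟨ν, hν, hiw⟩ | ⟨n, hn, D, hD, hc⟩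
    · have hlt : ν < spread (Fin n → X) := by
        rw [hiw] at hle
        exact lt_of_lt_of_le (Order.lt_succ ν) hle
      obtain ⟨D, hD, hc⟩ := exists_of_lt_spread hlt
      exact construct hn D hD (by rw [hiw]; exact Order.succ_le_of_lt hc)
    · exact construct hn D hD hc
end

section
/- Let X be an infinite zero-dimensional Tychonoff space. If some finite power X^n (n ≥ 1) has a discrete subspace of cardinality iw(X), then C_p(X) has a point-separating discrete subspace. -/
open Cardinal Set

universe u

theorem clopen_nhd {X : Type u} [TopologicalSpace X] [T35Space X]
    (hzd : ZeroDimensional X) (x : X) (V : Set X) (hV : IsOpen V) (hx : x ∈ V) :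
    ∃ W : Set X, IsClopen W ∧ x ∈ W ∧ W ⊆ V := by
  obtain ⟨f, hf, hfx, hfV⟩ := CompletelyRegularSpace.completely_regular x Vᶜ hV.isClosed_compl
    (by simpa using hx)
  have hfc : Continuous fun y => ((f y : ℝ)) := by fun_prop
  obtain ⟨U, hU, hA, hB⟩ := hzd {y | (f y : ℝ) = 0} {y | (f y : ℝ) - 1 = 0}
    ⟨fun y => (f y : ℝ), hfc, rfl⟩ ⟨fun y => (f y : ℝ) - 1, by fun_prop, rfl⟩
    (by
      rw [Set.disjoint_left]
      intro y h1 h2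
      simp only [Set.mem_ofPred_eq] at h1 h2
      linarith)
  refine ⟨U, hU, hA (by simp [hfx]), ?_⟩
  intro y hy
  by_contra hyV
  have h1 : f y = 1 := hfV hyV
  exact (Set.disjoint_left.1 hB) hy (by simp [h1])

/-- Point-separating clopen family indexed by a set of size at most the i-weight. -/
theorem exists_clopen_family {X : Type u} [t : TopologicalSpace X] [T35Space X] [Infinite X]
    (hzd : ZeroDimensional X) :
    ∃ (I : Type u) (U : I → Set X), #I ≤ iweight X ∧ (∀ i, IsClopen (U i)) ∧
      ∀ x y, x ≠ y → ∃ i, x ∈ U i ∧ y ∉ U i := by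
  classical
  haveI : Nonempty {t' : TopologicalSpace X // t ≤ t' ∧ @T35Space X t'} :=
    ⟨⟨t, le_rfl, inferInstance⟩⟩
  obtain ⟨⟨t', htt', h35⟩, ht'⟩ := ciInf_mem
    (fun t' : {t' : TopologicalSpace X // t ≤ t' ∧ @T35Space X t'} => @weight X t'.1)
  haveI : Nonempty {B : Set (Set X) // @TopologicalSpace.IsTopologicalBasis X t' B} :=
    ⟨⟨_, @TopologicalSpace.isTopologicalBasis_opens X t'⟩⟩
  obtain ⟨⟨B, hB⟩, hBw⟩ := ciInf_mem
    (fun B : {B : Set (Set X) // @TopologicalSpace.IsTopologicalBasis X t' B} => #↥B.1)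
  have hcard : #↥B = @iweight X t := by
    have h1 : #↥B = @weight X t' := hBw
    have h2 : @weight X t' = @iweight X t := ht'
    exact h1.trans h2
  have hsep : ∀ x y : X, x ≠ y → ∃ b c : B, x ∈ b.1 ∧ y ∈ c.1 ∧
      ∃ U : Set X, @IsClopen X t U ∧ b.1 ⊆ U ∧ Disjoint U c.1 := by
    intro x y hxy
    obtain ⟨f, hf, hfx, hfy⟩ : ∃ f : X → ℝ, @Continuous X ℝ t' _ f ∧ f x = 0 ∧ f y = 1 := by
      letI := t'
      obtain ⟨f, hf, hfx, hfy⟩ := CompletelyRegularSpace.completely_regular x {y}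
        (isClosed_singleton) (by simpa using hxy)
      refine ⟨fun z => (f z : ℝ), continuous_subtype_val.comp hf, by simp [hfx], ?_⟩
      have : f y = 1 := hfy rfl
      simp [this]
    have hft : @Continuous X ℝ t _ f := continuous_le_dom htt' hf
    obtain ⟨b, hb, hxb, hb'⟩ := hB.exists_subset_of_mem_open (a := x) (u := f ⁻¹' Iio (1/3))
      (by simp [hfx]) (isOpen_Iio.preimage hf)
    obtain ⟨c, hc, hyc, hc'⟩ := hB.exists_subset_of_mem_open (a := y) (u := f ⁻¹' Ioi (2/3))
      (by simp [hfy]; norm_num) (isOpen_Ioi.preimage hf)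
    refine ⟨⟨b, hb⟩, ⟨c, hc⟩, hxb, hyc, ?_⟩
    obtain ⟨U, hU, hA, hB⟩ := hzd {z | max (f z - 1/3) 0 = 0} {z | max (2/3 - f z) 0 = 0}
      ⟨fun z => max (f z - 1/3) 0, by fun_prop, rfl⟩
      ⟨fun z => max (2/3 - f z) 0, by fun_prop, rfl⟩
      (by
        rw [Set.disjoint_left]
        intro z h1 h2
        simp only [Set.mem_ofPred_eq, max_eq_right_iff] at h1 h2
        linarith)
    refine ⟨U, hU, fun z hz => hA ?_, hB.mono_right fun z hz => ?_⟩
    · have : f z < 1/3 := hb' hz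
      simp only [Set.mem_ofPred_eq, max_eq_right_iff]; linarith
    · have : 2/3 < f z := hc' hz
      simp only [Set.mem_ofPred_eq, max_eq_right_iff]; linarith
  haveI : Infinite B := by
    by_contra hfin
    rw [not_infinite_iff_finite] at hfin
    have : Function.Injective (fun (x : X) => {b : B | x ∈ b.1}) := by
      intro x y h
      by_contra hxy
      obtain ⟨b, c, hxb, hyc, U, -, hbU, hUc⟩ := hsep x y hxy
      have h1 : b ∈ {b : B | y ∈ b.1} := by
        have h2 : b ∈ {b : B | x ∈ b.1} := hxb
        simp only at h
        rwa [h] at h2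
      exact Set.disjoint_left.1 hUc (hbU h1) hyc
    exact not_finite_iff_infinite.2 ‹Infinite X› (Finite.of_injective _ this)
  refine ⟨B × B, fun p => if h : ∃ U : Set X, @IsClopen X t U ∧ p.1.1 ⊆ U ∧ Disjoint U p.2.1
    then h.choose else ∅, ?_, ?_, ?_⟩
  · rw [← hcard]; simp
  · intro p
    dsimp only
    split_ifs with h
    · exact h.choose_spec.1
    · exact @isClopen_empty X t
  · intro x y hxy
    obtain ⟨b, c, hxb, hyc, h⟩ := hsep x y hxy
    refine ⟨(b, c), ?_⟩
    dsimp only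
    rw [dif_pos h]
    exact ⟨h.choose_spec.2.1 hxb, fun hy => Set.disjoint_left.1 h.choose_spec.2.2 hy hyc⟩

theorem clopen_box {X : Type u} [TopologicalSpace X] [T35Space X]
    (hzd : ZeroDimensional X) {n : ℕ} (D : Set (Fin n → X)) [DiscreteTopology D] (d : D) :
    ∃ W : Fin n → Set X, (∀ i, IsClopen (W i)) ∧ (∀ i, d.1 i ∈ W i) ∧
      ∀ d' : D, (∀ i, d'.1 i ∈ W i) → d' = d := by
  obtain ⟨V, hV, hVd⟩ := isOpen_induced_iff.1 (isOpen_discrete ({d} : Set D))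
  have hdV : d.1 ∈ V := by
    have : d ∈ (Subtype.val ⁻¹' V : Set D) := by rw [hVd]; rfl
    exact this
  obtain ⟨u, hu, huV⟩ := isOpen_pi_iff'.1 hV d.1 hdV
  choose W hW hdW hWu using fun i => clopen_nhd hzd (d.1 i) (u i) (hu i).1 (hu i).2
  refine ⟨W, hW, hdW, fun d' h => ?_⟩
  have : d' ∈ (Subtype.val ⁻¹' V : Set D) := huV fun i _ => hWu i (h i)
  rw [hVd] at this
  exact this

/-- If `X` is zero-dimensional and some finite power `X^n` (`n ≥ 1`) has a discrete
subspace of cardinality `iw(X)`, then `C_p(X)` has a point-separating discrete subspace. -/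
theorem stmt8 {X : Type u} [TopologicalSpace X] [T35Space X] [Infinite X]
    (hzd : ZeroDimensional X)
    (hD : ∃ n : ℕ, 1 ≤ n ∧ ∃ D : Set (Fin n → X), DiscreteTopology ↥D ∧ #↥D = iweight X) :
    ∃ F : Set (Cp X), DiscreteTopology ↥F ∧ PointSep1 F := by
  classical
  obtain ⟨n, -, D, hDd, hDc⟩ := hD
  obtain ⟨I, U, hI, hU, hsep⟩ := exists_clopen_family hzd
  rw [← hDc] at hI
  obtain ⟨e⟩ := hI
  choose W hW hdW hWu using fun p : I => clopen_box hzd D (e p)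
  let T : I → X → (Fin n → Bool) × Bool := fun p x => (fun i => decide (x ∈ W p i), decide (x ∈ U p))
  have hdec : ∀ s : Set X, IsClopen s → Continuous fun x => decide (x ∈ s) := by
    intro s hs
    convert (continuous_boolIndicator_iff_isClopen s).2 hs using 1
    funext x
    by_cases hx : x ∈ s <;> simp [hx, Set.boolIndicator]
  have hT : ∀ p, Continuous (T p) := fun p =>
    (continuous_pi fun i => hdec _ (hW p i)).prodMk (hdec _ (hU p))
  let h : I → Cp X := fun p => ⟨fun x => ((Encodable.encode (T p x) : ℕ) : ℝ),
    (continuous_of_discreteTopology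
      (f := fun z : (Fin n → Bool) × Bool => ((Encodable.encode z : ℕ) : ℝ))).comp (hT p)⟩
  have hev : ∀ x : X, Continuous fun f : Cp X => f.1 x := fun x =>
    (continuous_apply x).comp continuous_subtype_val
  refine ⟨Set.range h, ?_, ?_⟩
  · rw [discreteTopology_iff_isOpen_singleton]
    rintro ⟨_, p, rfl⟩
    rw [isOpen_induced_iff]
    refine ⟨⋂ i : Fin n, (fun f : Cp X => f.1 ((e p).1 i)) ⁻¹'
      Metric.ball ((h p).1 ((e p).1 i)) 1,
      isOpen_iInter_of_finite fun i => Metric.isOpen_ball.preimage (hev _), ?_⟩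
    ext ⟨_, q, rfl⟩
    simp only [Set.mem_preimage, Set.mem_iInter, Set.mem_singleton_iff]
    constructor
    · intro hq
      suffices hpq : e p = e q by
        have hpq' := e.injective hpq
        subst hpq'
        rfl
      apply hWu q
      intro i
      have h1 := hq i
      have h2 : T q ((e p).1 i) = T p ((e p).1 i) := by
        apply Encodable.encode_injective
        rw [Metric.mem_ball] at h1
        simp only [h, Nat.dist_cast_real] at h1
        by_contra hne
        exact absurd (Nat.pairwise_one_le_dist hne) (not_le.2 h1)
      have h3 := congrFun (congrArg Prod.fst h2) i
      simp only [T] at h3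
      simpa [hdW p i] using h3
    · intro hq i
      have hq' : h q = h p := congrArg Subtype.val hq
      rw [hq']
      exact Metric.mem_ball_self one_pos
  · intro x y hxy
    obtain ⟨p, hx, hy⟩ := hsep x y hxy
    refine ⟨h p, ⟨p, rfl⟩, fun heq => ?_⟩
    have h2 : T p x = T p y := Encodable.encode_injective (Nat.cast_injective heq)
    have h3 := congrArg Prod.snd h2
    simp only [T] at h3
    simp [hx, hy] at h3
end
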